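/- arXiv:math/9201230 — 3 statements merged into one kernel-verified Lean document; each statement's English description precedes it below -/
import Mathlib

section
/- Let 2 < p < ∞ and let (e_i) be the unit vector basis of ℓ^p. Let X = J(e_i) be the James-type space over (e_i). Then X has Property (w), but the dual X' is not weakly sequentially complete. -/
open Filter Topology

noncomputable section

/-- An operator between normed spaces is *weakly compact* if the image of the closed unit
ball is relatively compact in the weak topology of the codomain. -/
def IsWeaklyCompactOperator {X Y : Type*} [NormedAddCommGroup X] [NormedSpace ℝ X]
    [NormedAddCommGroup Y] [NormedSpace ℝ Y] (T : X →L[ℝ] Y) : Prop :=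
  IsCompact (closure (toWeakSpace ℝ Y '' (T '' Metric.closedBall 0 1)))

/-- An operator between normed spaces is *compact* if the image of the closed unit ball is
relatively norm-compact. -/
def IsCompactOp {X Y : Type*} [NormedAddCommGroup X] [NormedSpace ℝ X]
    [NormedAddCommGroup Y] [NormedSpace ℝ Y] (T : X →L[ℝ] Y) : Prop :=
  IsCompact (closure (T '' Metric.closedBall 0 1))

/-- A Banach space has *Property (w)* if every operator into its dual is weakly compact. -/
def PropertyW (X : Type*) [NormedAddCommGroup X] [NormedSpace ℝ X] : Prop :=
  ∀ T : X →L[ℝ] (X →L[ℝ] ℝ), IsWeaklyCompactOperator T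

/-- A normed space is *weakly sequentially complete* if every weakly Cauchy sequence is
weakly convergent. -/
def WeaklySeqComplete (X : Type*) [NormedAddCommGroup X] [NormedSpace ℝ X] : Prop :=
  ∀ x : ℕ → X,
    (∀ f : X →L[ℝ] ℝ, ∃ L : ℝ, Tendsto (fun n => f (x n)) atTop (𝓝 L)) →
    ∃ x₀ : X, ∀ f : X →L[ℝ] ℝ, Tendsto (fun n => f (x n)) atTop (𝓝 (f x₀))

/-- A normed space is reflexive if the canonical embedding into the double dual is
surjective. -/
def IsReflexiveSpace (X : Type*) [NormedAddCommGroup X] [NormedSpace ℝ X] : Prop :=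
  Function.Surjective (NormedSpace.inclusionInDoubleDual ℝ X)

/-- `(e i)` is a normalized unconditional basic sequence. -/
def IsNormalizedUnconditionalBasic {E : Type*} [NormedAddCommGroup E] [NormedSpace ℝ E]
    (e : ℕ → E) : Prop :=
  (∀ i, ‖e i‖ = 1) ∧
  ∃ C : ℝ, ∀ S F : Finset ℕ, S ⊆ F → ∀ a : ℕ → ℝ,
    ‖∑ i ∈ S, a i • e i‖ ≤ C * ‖∑ i ∈ F, a i • e i‖

/-- `(x i)` dominates `(y i)`. -/
def Dominates {X Y : Type*} [NormedAddCommGroup X] [NormedSpace ℝ X]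
    [NormedAddCommGroup Y] [NormedSpace ℝ Y] (x : ℕ → X) (y : ℕ → Y) : Prop :=
  ∃ C : ℝ, ∀ (s : Finset ℕ) (a : ℕ → ℝ),
    ‖∑ i ∈ s, a i • y i‖ ≤ C * ‖∑ i ∈ s, a i • x i‖

/-- Two sequences are equivalent if each dominates the other. -/
def EquivalentSeq {X Y : Type*} [NormedAddCommGroup X] [NormedSpace ℝ X]
    [NormedAddCommGroup Y] [NormedSpace ℝ Y] (x : ℕ → X) (y : ℕ → Y) : Prop :=
  Dominates x y ∧ Dominates y x

/-- `(v n)` is a block basis of `(e i)`. -/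
def IsBlockBasis {E : Type*} [NormedAddCommGroup E] [NormedSpace ℝ E]
    (e v : ℕ → E) : Prop :=
  ∃ q : ℕ → ℕ, StrictMono q ∧ ∃ a : ℕ → ℝ,
    ∀ n, v n ≠ 0 ∧ v n = ∑ i ∈ Finset.Ico (q n) (q (n + 1)), a i • e i

/-- A sequence is semi-normalized. -/
def SemiNormalized {E : Type*} [NormedAddCommGroup E] (x : ℕ → E) : Prop :=
  ∃ c C : ℝ, 0 < c ∧ ∀ i, c ≤ ‖x i‖ ∧ ‖x i‖ ≤ C

/-- `(e i)` is right dominant. -/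
def RightDominantBound {E : Type*} [NormedAddCommGroup E] [NormedSpace ℝ E]
    (e : ℕ → E) : Prop :=
  ∃ C : ℝ, ∀ m n : ℕ → ℕ, (∀ i, m i ≤ n i) → (∀ i, n i < m (i + 1)) →
    ∀ (s : Finset ℕ) (a : ℕ → ℝ),
      ‖∑ i ∈ s, a i • e (m i)‖ ≤ C * ‖∑ i ∈ s, a i • e (n i)‖

/-- The James norm associated to `(e i)` of a (finitely supported) scalar sequence. -/
def jamesNorm {E : Type*} [NormedAddCommGroup E] [NormedSpace ℝ E]
    (e : ℕ → E) (a : ℕ → ℝ) : ℝ :=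
  sSup { x : ℝ | ∃ (k : ℕ) (p : ℕ → ℕ), 0 < k ∧ p 0 = 0 ∧ StrictMono p ∧
    x = ‖∑ i ∈ Finset.range k, (∑ j ∈ Finset.Ico (p i) (p (i + 1)), a j) • e (p i)‖ }

/-- `X`, together with the sequence `(u i)`, is the James-type space over `(e i)`. -/
def IsJamesSpace {E X : Type*} [NormedAddCommGroup E] [NormedSpace ℝ E]
    [NormedAddCommGroup X] [NormedSpace ℝ X] (e : ℕ → E) (u : ℕ → X) : Prop :=
  Dense (Submodule.span ℝ (Set.range u) : Set X) ∧
  ∀ a : ℕ →₀ ℝ, ‖∑ i ∈ a.support, a i • u i‖ = jamesNorm e (a : ℕ → ℝ)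

/-- `(e i)` is shrinking: the span of the biorthogonal functionals is dense in the dual of
the closed linear span of `(e i)`. -/
def IsShrinking {E : Type*} [NormedAddCommGroup E] [NormedSpace ℝ E] (e : ℕ → E) : Prop :=
  ∃ e' : ℕ → ((Submodule.span ℝ (Set.range e)).topologicalClosure →L[ℝ] ℝ),
    (∀ i j, e' i ⟨e j, Submodule.le_topologicalClosure _
        (Submodule.subset_span (Set.mem_range_self j))⟩ = if i = j then 1 else 0) ∧
    Dense (Submodule.span ℝ (Set.range e') :
      Set ((Submodule.span ℝ (Set.range e)).topologicalClosure →L[ℝ] ℝ))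

/-- `E` satisfies an upper `p`-estimate with respect to the unconditional basis `(e i)`. -/
def UpperPEstimate {E : Type*} [NormedAddCommGroup E] [NormedSpace ℝ E]
    (e : ℕ → E) (p : ℝ) : Prop :=
  ∃ C : ℝ, ∀ (n : ℕ) (x : ℕ → E) (s : ℕ → Finset ℕ) (a : ℕ → ℕ → ℝ),
    (∀ k, k < n → x k = ∑ i ∈ s k, a k i • e i) →
    (∀ k l, k < n → l < n → k ≠ l → Disjoint (s k) (s l)) →
    ‖∑ k ∈ Finset.range n, x k‖ ≤ C * (∑ k ∈ Finset.range n, ‖x k‖ ^ p) ^ (1 / p)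

/-- `(e i)` is subsymmetric: unconditional and equivalent to all of its subsequences. -/
def IsSubsymmetric {E : Type*} [NormedAddCommGroup E] [NormedSpace ℝ E] (e : ℕ → E) : Prop :=
  (∃ C : ℝ, ∀ S F : Finset ℕ, S ⊆ F → ∀ a : ℕ → ℝ,
    ‖∑ i ∈ S, a i • e i‖ ≤ C * ‖∑ i ∈ F, a i • e i‖) ∧
  ∀ φ : ℕ → ℕ, StrictMono φ → EquivalentSeq e (e ∘ φ)

/-- `(e i)` is a symmetric basic sequence: equivalent to all of its permutations. -/
def IsSymmetricSeq {E : Type*} [NormedAddCommGroup E] [NormedSpace ℝ E] (e : ℕ → E) : Prop :=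
  ∀ σ : Equiv.Perm ℕ, EquivalentSeq e (fun i => e (σ i))

/-- A topological space is scattered if every nonempty closed subset has a point isolated
in that subset. -/
def Scattered (K : Type*) [TopologicalSpace K] : Prop :=
  ∀ C : Set K, C.Nonempty → IsClosed C → ∃ x ∈ C, ∃ U : Set K, IsOpen U ∧ U ∩ C = {x}

end

namespace JT

theorem weakly_compact_of {X Y : Type*} [NormedAddCommGroup X] [NormedSpace ℝ X]
    [NormedAddCommGroup Y] [NormedSpace ℝ Y] (T : X →L[ℝ] Y)
    (h : ∀ ξ : (X →L[ℝ] ℝ) →L[ℝ] ℝ, ∃ G : Y, ∀ F : Y →L[ℝ] ℝ, F G = ξ (F.comp T)) :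
    IsWeaklyCompactOperator T := by
  choose G hG using h
  let g : WeakDual ℝ (X →L[ℝ] ℝ) → WeakSpace ℝ Y :=
    fun ξ => toWeakSpace ℝ Y (G (WeakDual.toStrongDual ξ))
  have hg : Continuous g := by
    refine WeakBilin.continuous_of_continuous_eval _ ?_
    intro F
    have : (fun a => ((topDualPairing ℝ Y).flip (g a)) F) = fun a => a ((F : Y →L[ℝ] ℝ).comp T) := by
      funext a
      exact hG _ F
    rw [this]
    exact WeakDual.eval_continuous _
  have hK := (WeakDual.isCompact_closedBall (𝕜 := ℝ) (E := X →L[ℝ] ℝ) 0 1).image hg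
  refine hK.closure_of_subset ?_
  rintro _ ⟨_, ⟨x, hx, rfl⟩, rfl⟩
  refine ⟨StrongDual.toWeakDual (NormedSpace.inclusionInDoubleDual ℝ X x), ?_, ?_⟩
  · simp only [Set.mem_preimage, mem_closedBall_zero_iff] at hx ⊢
    exact (NormedSpace.double_dual_bound ℝ X x).trans hx
  · have : G (NormedSpace.inclusionInDoubleDual ℝ X x) = T x := by
      refine (SeparatingDual.eq_iff_forall_dual_eq (R := ℝ)).2 (fun F => ?_)
      rw [hG]; rfl
    show toWeakSpace ℝ Y (G (NormedSpace.inclusionInDoubleDual ℝ X x)) = _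
    rw [this]

/-- partial sums -/
noncomputable def S (a : ℕ →₀ ℝ) (n : ℕ) : ℝ := ∑ j ∈ Finset.range n, a j

theorem strictify (f : ℕ → ℕ → ℝ) (h0 : ∀ a b, 0 ≤ f a b) (h1 : ∀ a, f a a = 0)
    (π : ℕ → ℕ) (hπ : Monotone π) (k : ℕ) :
    ∃ (k' : ℕ) (ρ : ℕ → ℕ), ρ 0 = 0 ∧ StrictMono ρ ∧ ρ k' = π k ∧
      ∑ i ∈ Finset.range k, f (π i) (π (i + 1)) ≤ ∑ i ∈ Finset.range k', f (ρ i) (ρ (i + 1)) := by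
  induction k with
  | zero =>
    by_cases h : π 0 = 0
    · exact ⟨0, id, rfl, strictMono_id, h.symm, by simp⟩
    · refine ⟨1, fun i => if i = 0 then 0 else π 0 + (i - 1), by simp, ?_, by simp, ?_⟩
      · refine strictMono_nat_of_lt_succ (fun n => ?_)
        rcases n with _ | n
        · simp; omega
        · simp
      · simp [h0]
  | succ k ih =>
    obtain ⟨k', ρ, hρ0, hρ, hk, hs⟩ := ih
    rcases (hπ (Nat.le_succ k)).eq_or_lt with h | h
    · refine ⟨k', ρ, hρ0, hρ, hk.trans h, ?_⟩
      rw [Finset.sum_range_succ, ← Nat.succ_eq_add_one, ← h, h1, add_zero]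
      exact hs
    · refine ⟨k' + 1, fun i => if i ≤ k' then ρ i else π (k + 1) + (i - (k' + 1)), by simp [hρ0],
        ?_, by simp, ?_⟩
      · refine strictMono_nat_of_lt_succ (fun n => ?_)
        rcases lt_trichotomy n k' with hn | hn | hn
        · simp only [hn.le, if_true, Nat.succ_le_of_lt hn]
          exact hρ (Nat.lt_succ_self n)
        · subst hn
          simp [hk]; exact h
        · rw [if_neg (by omega), if_neg (by omega)]; omega
      · rw [Finset.sum_range_succ, Finset.sum_range_succ]
        refine add_le_add ?_ ?_
        · refine hs.trans (le_of_eq (Finset.sum_congr rfl fun i hi => ?_))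
          rw [Finset.mem_range] at hi
          simp only [hi.le, if_true, show i + 1 ≤ k' from hi]
        · simp [hk]

open scoped ENNReal in
theorem norm_facts (p : ℝ≥0∞) [Fact (1 ≤ p)] (hp2 : (2 : ℝ≥0∞) < p) (hp' : p < ⊤)
    {X : Type*} [NormedAddCommGroup X] [NormedSpace ℝ X] (u : ℕ → X)
    (hJ : IsJamesSpace (fun i => (lp.single p i 1 : lp (fun _ : ℕ => ℝ) p)) u) :
    (∀ (a : ℕ →₀ ℝ) (k : ℕ) (π : ℕ → ℕ), Monotone π →
      ∑ i ∈ Finset.range k, |S a (π (i + 1)) - S a (π i)| ^ p.toReal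
        ≤ ‖Finsupp.linearCombination ℝ u a‖ ^ p.toReal) ∧
    (∀ (a : ℕ →₀ ℝ) (C : ℝ), (∀ (k : ℕ) (π : ℕ → ℕ), Monotone π →
      ∑ i ∈ Finset.range k, |S a (π (i + 1)) - S a (π i)| ^ p.toReal ≤ C) →
        ‖Finsupp.linearCombination ℝ u a‖ ^ p.toReal ≤ C) := by
  have hr : 2 < p.toReal := by
    rw [← ENNReal.toReal_ofNat 2]
    exact (ENNReal.toReal_lt_toReal (by simp) hp'.ne).2 hp2
  have hr0 : 0 < p.toReal := by linarith
  have hpart : ∀ (a : ℕ →₀ ℝ) (k : ℕ) (π : ℕ → ℕ), StrictMono π →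
      ‖∑ i ∈ Finset.range k, (∑ j ∈ Finset.Ico (π i) (π (i + 1)), a j) •
        (lp.single p (π i) 1 : lp (fun _ : ℕ => ℝ) p)‖ ^ p.toReal
      = ∑ i ∈ Finset.range k, |S a (π (i + 1)) - S a (π i)| ^ p.toReal := by
    intro a k π hπ
    let c : ℕ → ℝ := fun i => S a (π (i + 1)) - S a (π i)
    let d : ℕ → ℝ := fun n => c (Function.invFun π n)
    have hd : ∀ i, d (π i) = c i := fun i => by
      simp only [d]; rw [Function.leftInverse_invFun hπ.injective i]
    have h1 := lp.norm_sum_single (E := fun _ : ℕ => ℝ) (p := p) hr0 d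
      ((Finset.range k).map ⟨π, hπ.injective⟩)
    rw [Finset.sum_map, Finset.sum_map] at h1
    simp only [Function.Embedding.coeFn_mk, hd, Real.norm_eq_abs] at h1
    rw [← h1]
    congr 2
    refine Finset.sum_congr rfl fun i _ => ?_
    rw [Finset.sum_Ico_eq_sub _ (hπ (Nat.lt_succ_self i)).le, ← lp.single_smul]
    simp [c, S]
  have hL : ∀ a : ℕ →₀ ℝ, ‖Finsupp.linearCombination ℝ u a‖ =
      jamesNorm (fun i => (lp.single p i 1 : lp (fun _ : ℕ => ℝ) p)) a := fun a => hJ.2 a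
  have hbdd : ∀ a : ℕ →₀ ℝ, BddAbove { x : ℝ | ∃ (k : ℕ) (π : ℕ → ℕ), 0 < k ∧ π 0 = 0 ∧ StrictMono π ∧
    x = ‖∑ i ∈ Finset.range k, (∑ j ∈ Finset.Ico (π i) (π (i + 1)), a j) •
      (lp.single p (π i) 1 : lp (fun _ : ℕ => ℝ) p)‖ } := by
    intro a
    refine ⟨∑ j ∈ a.support, |a j|, ?_⟩
    rintro _ ⟨k, π, -, hπ0, hπ, rfl⟩
    have hk : ∀ k, ∑ i ∈ Finset.range k, ∑ j ∈ Finset.Ico (π i) (π (i + 1)), |a j| =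
        ∑ j ∈ Finset.range (π k), |a j| := by
      intro k
      induction k with
      | zero => simp [hπ0]
      | succ k ih =>
        rw [Finset.sum_range_succ, ih, Finset.sum_range_add_sum_Ico _ (hπ (Nat.lt_succ_self k)).le]
    calc _ ≤ ∑ i ∈ Finset.range k, ∑ j ∈ Finset.Ico (π i) (π (i + 1)), |a j| := by
          refine (norm_sum_le _ _).trans (Finset.sum_le_sum fun i _ => ?_)
          rw [norm_smul, lp.norm_single (zero_lt_two.trans hp2)]
          simp only [norm_one, mul_one]
          exact Finset.abs_sum_le_sum_abs _ _
      _ = ∑ j ∈ Finset.range (π k), |a j| := hk k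
      _ ≤ ∑ j ∈ Finset.range (π k) ∪ a.support, |a j| :=
          Finset.sum_le_sum_of_subset_of_nonneg Finset.subset_union_left (fun _ _ _ => abs_nonneg _)
      _ = ∑ j ∈ a.support, |a j| := by
          symm
          refine Finset.sum_subset Finset.subset_union_right (fun j _ hj => ?_)
          simpa using hj
  constructor
  · intro a k π hπ
    obtain ⟨k', ρ, hρ0, hρ, -, hs⟩ := strictify (fun m n => |S a n - S a m| ^ p.toReal)
      (fun _ _ => by positivity) (fun _ => by simp [hr0.ne']) π hπ k
    refine hs.trans ?_
    rcases Nat.eq_zero_or_pos k' with rfl | hk'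
    · simp; positivity
    rw [← hpart a k' ρ hρ, hL]
    refine Real.rpow_le_rpow (norm_nonneg _) ?_ hr0.le
    exact le_csSup (hbdd a) ⟨k', ρ, hk', hρ0, hρ, rfl⟩
  · intro a C h
    have hC : 0 ≤ C := by simpa using h 0 id monotone_id
    rw [← Real.le_rpow_inv_iff_of_pos (norm_nonneg _) hC hr0, hL]
    refine csSup_le ⟨_, 1, id, one_pos, rfl, strictMono_id, rfl⟩ ?_
    rintro _ ⟨k, π, -, -, hπ, rfl⟩
    rw [Real.le_rpow_inv_iff_of_pos (norm_nonneg _) hC hr0, hpart a k π hπ]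
    exact h k π hπ.monotone

structure Ctx {X : Type*} [NormedAddCommGroup X] [NormedSpace ℝ X] (r : ℝ) (u : ℕ → X) : Prop where
  hr : 2 < r
  dense : DenseRange (Finsupp.linearCombination ℝ u)
  N1 : ∀ (a : ℕ →₀ ℝ) (k : ℕ) (π : ℕ → ℕ), Monotone π →
      ∑ i ∈ Finset.range k, |S a (π (i + 1)) - S a (π i)| ^ r
        ≤ ‖Finsupp.linearCombination ℝ u a‖ ^ r
  N2 : ∀ (a : ℕ →₀ ℝ) (C : ℝ), (∀ (k : ℕ) (π : ℕ → ℕ), Monotone π →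
      ∑ i ∈ Finset.range k, |S a (π (i + 1)) - S a (π i)| ^ r ≤ C) →
        ‖Finsupp.linearCombination ℝ u a‖ ^ r ≤ C

theorem S_add (a b : ℕ →₀ ℝ) (n : ℕ) : S (a + b) n = S a n + S b n := by
  simp [S, Finset.sum_add_distrib]

theorem S_sub (a b : ℕ →₀ ℝ) (n : ℕ) : S (a - b) n = S a n - S b n := by
  simp [S, Finset.sum_sub_distrib]

theorem S_smul (c : ℝ) (a : ℕ →₀ ℝ) (n : ℕ) : S (c • a) n = c * S a n := by
  simp [S, Finset.mul_sum]

theorem S_sum {ι : Type*} (s : Finset ι) (b : ι → ℕ →₀ ℝ) (n : ℕ) :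
    S (∑ k ∈ s, b k) n = ∑ k ∈ s, S (b k) n := by
  simp only [S, Finsupp.finsetSum_apply]
  rw [Finset.sum_comm]

theorem S_single (i n : ℕ) (c : ℝ) : S (Finsupp.single i c) n = if i < n then c else 0 := by
  simp [S, Finsupp.single_apply]

theorem S_lo {a : ℕ →₀ ℝ} {n : ℕ} (h : ∀ j < n, a j = 0) {m : ℕ} (hm : m ≤ n) : S a m = 0 :=
  Finset.sum_eq_zero fun j hj => h j (by rw [Finset.mem_range] at hj; omega)

theorem S_hi {a : ℕ →₀ ℝ} {n : ℕ} (h : ∀ j, n ≤ j → a j = 0) {m : ℕ} (hm : n ≤ m) :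
    S a m = S a n := by
  unfold S
  symm
  refine Finset.sum_subset (by simpa using hm) (fun j _ hj => h j (by simpa using hj))

theorem exists_hi (a : ℕ →₀ ℝ) (n : ℕ) : ∃ m, n ≤ m ∧ ∀ j, m ≤ j → a j = 0 := by
  refine ⟨max n (a.support.sup id + 1), le_max_left _ _, fun j hj => ?_⟩
  by_contra h
  have : j ≤ a.support.sup id := Finset.le_sup (f := id) (by simpa using h)
  omega

section
variable {X : Type*} [NormedAddCommGroup X] [NormedSpace ℝ X] {r : ℝ} {u : ℕ → X}

theorem lower_est (H : Ctx r u) (a b : ℕ →₀ ℝ) (n : ℕ) (ha : ∀ j, n ≤ j → a j = 0)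
    (hb : ∀ j < n, b j = 0) :
    ‖Finsupp.linearCombination ℝ u a‖ ^ r + ‖Finsupp.linearCombination ℝ u b‖ ^ r
      ≤ ‖Finsupp.linearCombination ℝ u (a + b)‖ ^ r := by
  rw [← le_sub_iff_add_le']
  refine H.N2 b _ (fun k' π' hπ' => ?_)
  rw [le_sub_comm]
  refine H.N2 a _ (fun k π hπ => ?_)
  rw [le_sub_iff_add_le]
  let ρ : ℕ → ℕ := fun i => if i ≤ k then min (π i) n else max (π' (i - (k + 1))) n
  have hρ : Monotone ρ := by
    refine monotone_nat_of_le_succ (fun i => ?_)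
    simp only [ρ]
    rcases lt_trichotomy i k with h | h | h
    · rw [if_pos h.le, if_pos (by omega)]
      exact min_le_min_right _ (hπ (Nat.le_succ i))
    · rw [if_pos h.le, if_neg (by omega)]
      exact (min_le_right _ _).trans (le_max_right _ _)
    · rw [if_neg (by omega), if_neg (by omega)]
      exact max_le_max_right _ (hπ' (by omega))
  refine le_trans ?_ (H.N1 (a + b) (k + 1 + k') ρ hρ)
  have hSb : ∀ m, S b (min m n) = 0 := fun m => S_lo hb (min_le_right _ _)
  have hSa : ∀ m, S a (max m n) = S a n := fun m => S_hi ha (le_max_right _ _)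
  have hSb' : ∀ m, S b (max m n) = S b m := fun m => by
    rcases le_total m n with h | h
    · rw [max_eq_right h, S_lo hb le_rfl, S_lo hb h]
    · rw [max_eq_left h]
  have hSa' : ∀ m, S a (min m n) = S a m := fun m => by
    rcases le_total m n with h | h
    · rw [min_eq_left h]
    · rw [min_eq_right h, S_hi ha h]
  rw [Finset.sum_range_add, Finset.sum_range_succ]
  have e1 : ∑ i ∈ Finset.range k, |S (a + b) (ρ (i + 1)) - S (a + b) (ρ i)| ^ r =
      ∑ i ∈ Finset.range k, |S a (π (i + 1)) - S a (π i)| ^ r := by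
    refine Finset.sum_congr rfl fun i hi => ?_
    rw [Finset.mem_range] at hi
    simp only [ρ, hi.le, if_true, show i + 1 ≤ k from hi, S_add, hSb, hSa', add_zero]
  have e2 : ∑ i ∈ Finset.range k', |S (a + b) (ρ (k + 1 + i + 1)) - S (a + b) (ρ (k + 1 + i))| ^ r =
      ∑ i ∈ Finset.range k', |S b (π' (i + 1)) - S b (π' i)| ^ r := by
    refine Finset.sum_congr rfl fun i hi => ?_
    simp only [ρ]
    rw [if_neg (by omega), if_neg (by omega), show k + 1 + i + 1 - (k + 1) = i + 1 by omega,
      show k + 1 + i - (k + 1) = i by omega]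
    simp only [S_add, hSa, hSb']
    congr 2
    ring
  rw [e1, e2]
  have : 0 ≤ |S (a + b) (ρ (k + 1)) - S (a + b) (ρ k)| ^ r := by positivity
  linarith

theorem norm_le_of_rpow (H : Ctx r u) {x y : ℝ} (hx : 0 ≤ x) (hy : 0 ≤ y) (h : x ^ r ≤ y ^ r) :
    x ≤ y := (Real.rpow_le_rpow_iff hx hy (by linarith [H.hr])).1 h

theorem left_le (H : Ctx r u) (a b : ℕ →₀ ℝ) (n : ℕ) (ha : ∀ j, n ≤ j → a j = 0)
    (hb : ∀ j < n, b j = 0) :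
    ‖Finsupp.linearCombination ℝ u a‖ ≤ ‖Finsupp.linearCombination ℝ u (a + b)‖ := by
  refine norm_le_of_rpow H (norm_nonneg _) (norm_nonneg _) ?_
  have := lower_est H a b n ha hb
  have : 0 ≤ ‖Finsupp.linearCombination ℝ u b‖ ^ r := by positivity
  linarith

theorem right_le (H : Ctx r u) (a b : ℕ →₀ ℝ) (n : ℕ) (ha : ∀ j, n ≤ j → a j = 0)
    (hb : ∀ j < n, b j = 0) :
    ‖Finsupp.linearCombination ℝ u b‖ ≤ ‖Finsupp.linearCombination ℝ u (a + b)‖ := by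
  refine norm_le_of_rpow H (norm_nonneg _) (norm_nonneg _) ?_
  have := lower_est H a b n ha hb
  have : 0 ≤ ‖Finsupp.linearCombination ℝ u a‖ ^ r := by positivity
  linarith

theorem ptwise (hr : 1 ≤ r) (N : ℕ) (s t : ℕ → ℝ)
    (hs : ∀ k l, k ≠ l → s k = 0 ∨ s l = 0) (ht : ∀ k l, k ≠ l → t k = 0 ∨ t l = 0) :
    |∑ k ∈ Finset.range N, (t k - s k)| ^ r ≤
      2 ^ (r - 1) * ∑ k ∈ Finset.range N, |t k - s k| ^ r := by
  classical
  let A := (Finset.range N).filter (fun k => t k - s k ≠ 0)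
  have hA : A.card ≤ 2 := by
    have h1 : A ⊆ (Finset.range N).filter (fun k => s k ≠ 0) ∪
        (Finset.range N).filter (fun k => t k ≠ 0) := by
      intro k hk
      simp only [A, Finset.mem_filter, Finset.mem_union] at hk ⊢
      by_cases h : s k = 0
      · right; refine ⟨hk.1, fun h' => hk.2 (by rw [h, h', sub_zero])⟩
      · left; exact ⟨hk.1, h⟩
    have h2 : ((Finset.range N).filter (fun k => s k ≠ 0)).card ≤ 1 := by
      refine Finset.card_le_one.2 (fun k hk l hl => ?_)
      simp only [Finset.mem_filter] at hk hl
      by_contra h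
      rcases hs k l h with h | h
      · exact hk.2 h
      · exact hl.2 h
    have h3 : ((Finset.range N).filter (fun k => t k ≠ 0)).card ≤ 1 := by
      refine Finset.card_le_one.2 (fun k hk l hl => ?_)
      simp only [Finset.mem_filter] at hk hl
      by_contra h
      rcases ht k l h with h | h
      · exact hk.2 h
      · exact hl.2 h
    have := (Finset.card_le_card h1).trans (Finset.card_union_le _ _)
    omega
  have e : ∑ k ∈ Finset.range N, (t k - s k) = ∑ k ∈ A, (t k - s k) :=
    (Finset.sum_filter_ne_zero _).symm
  calc |∑ k ∈ Finset.range N, (t k - s k)| ^ r ≤ (∑ k ∈ A, |t k - s k|) ^ r := by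
        rw [e]
        exact Real.rpow_le_rpow (abs_nonneg _) (Finset.abs_sum_le_sum_abs _ _) (by linarith)
    _ ≤ (A.card : ℝ) ^ (r - 1) * ∑ k ∈ A, |t k - s k| ^ r :=
        Real.rpow_sum_le_const_mul_sum_rpow _ _ hr
    _ ≤ 2 ^ (r - 1) * ∑ k ∈ Finset.range N, |t k - s k| ^ r := by
        refine mul_le_mul ?_ ?_ (Finset.sum_nonneg fun _ _ => by positivity) (by positivity)
        · exact Real.rpow_le_rpow (by positivity) (by exact_mod_cast hA) (by linarith)
        · exact Finset.sum_le_sum_of_subset_of_nonneg (Finset.filter_subset _ _)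
            (fun _ _ _ => by positivity)

theorem upper_est (H : Ctx r u) (N : ℕ) (b : ℕ → ℕ →₀ ℝ)
    (hb : ∀ n k l, k ≠ l → S (b k) n = 0 ∨ S (b l) n = 0)
    (hn : ∀ k, ‖Finsupp.linearCombination ℝ u (b k)‖ ≤ 2) :
    ‖Finsupp.linearCombination ℝ u (∑ k ∈ Finset.range N, b k)‖ ^ r ≤ 2 ^ (r - 1) * 2 ^ r * N := by
  have hr := H.hr
  refine H.N2 _ _ (fun k π hπ => ?_)
  calc _ ≤ ∑ i ∈ Finset.range k, 2 ^ (r - 1) *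
        ∑ l ∈ Finset.range N, |S (b l) (π (i + 1)) - S (b l) (π i)| ^ r := by
        refine Finset.sum_le_sum fun i _ => ?_
        rw [S_sum, S_sum, ← Finset.sum_sub_distrib]
        exact ptwise (by linarith) N _ _ (hb _) (hb _)
    _ = 2 ^ (r - 1) * ∑ l ∈ Finset.range N, ∑ i ∈ Finset.range k,
          |S (b l) (π (i + 1)) - S (b l) (π i)| ^ r := by
        rw [← Finset.mul_sum, Finset.sum_comm]
    _ ≤ 2 ^ (r - 1) * ∑ l ∈ Finset.range N, 2 ^ r := by
        refine mul_le_mul_of_nonneg_left (Finset.sum_le_sum fun l _ => ?_) (by positivity)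
        exact (H.N1 (b l) k π hπ).trans
          (Real.rpow_le_rpow (norm_nonneg _) (hn l) (by linarith))
    _ = 2 ^ (r - 1) * 2 ^ r * N := by simp; ring

theorem growth (hr : 2 < r) {δ : ℝ} (hδ : 0 < δ) (M : ℝ) :
    ∃ N : ℕ, 0 < N ∧ M * (N : ℝ) ^ 2 < (N * δ) ^ r := by
  have h : Tendsto (fun N : ℕ => (N : ℝ) ^ (r - 2)) atTop atTop :=
    (tendsto_rpow_atTop (by linarith)).comp tendsto_natCast_atTop_atTop
  obtain ⟨N, h1, h2⟩ := ((h.eventually_gt_atTop (M / δ ^ r)).and (eventually_gt_atTop 0)).exists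
  refine ⟨N, h2, ?_⟩
  have hN : (0 : ℝ) < N := by exact_mod_cast h2
  have hd : 0 < δ ^ r := by positivity
  rw [div_lt_iff₀ hd] at h1
  rw [Real.mul_rpow hN.le hδ.le]
  have : (N : ℝ) ^ r = (N : ℝ) ^ (r - 2) * (N : ℝ) ^ 2 := by
    rw [← Real.rpow_natCast (N : ℝ) 2, ← Real.rpow_add hN]; norm_num
  rw [this]
  have h3 : 0 < (N : ℝ) ^ 2 := by positivity
  nlinarith [mul_lt_mul_of_pos_right h1 h3]

theorem abs_S_le (H : Ctx r u) (a : ℕ →₀ ℝ) (m n : ℕ) (h : m ≤ n) :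
    |S a n - S a m| ≤ ‖Finsupp.linearCombination ℝ u a‖ := by
  refine norm_le_of_rpow H (abs_nonneg _) (norm_nonneg _) ?_
  have := H.N1 a 1 (fun i => if i = 0 then m else n) (by
    refine monotone_nat_of_le_succ (fun i => ?_)
    rcases i with _ | i <;> simp [h])
  simpa using this

theorem norm_u_le (H : Ctx r u) (i : ℕ) : ‖u i‖ ≤ 1 := by
  have hr := H.hr
  have key : ‖Finsupp.linearCombination ℝ u (Finsupp.single i 1)‖ ^ r ≤ 1 := by
    refine H.N2 _ _ (fun k π hπ => ?_)
    have : ∀ j, |S (Finsupp.single i 1) (π (j + 1)) - S (Finsupp.single i 1) (π j)| ^ r =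
        S (Finsupp.single i 1) (π (j + 1)) - S (Finsupp.single i 1) (π j) := by
      intro j
      have := hπ (Nat.le_succ j)
      simp only [Nat.succ_eq_add_one] at this
      simp only [S_single]
      split_ifs <;> first | omega | simp [show r ≠ 0 by linarith]
    simp only [this]
    rw [Finset.sum_range_sub (fun j => S (Finsupp.single i 1) (π j))]
    simp only [S_single]
    split_ifs <;> norm_num
  rw [Finsupp.linearCombination_single, one_smul] at key
  refine norm_le_of_rpow H (norm_nonneg _) zero_le_one ?_
  simpa using key

theorem norm_single_sub (H : Ctx r u) (i j : ℕ) :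
    ‖Finsupp.linearCombination ℝ u (Finsupp.single i 1 - Finsupp.single j 1)‖ ≤ 2 := by
  rw [map_sub, Finsupp.linearCombination_single, Finsupp.linearCombination_single, one_smul, one_smul]
  have := norm_sub_le (u i) (u j)
  linarith [norm_u_le H i, norm_u_le H j]

def Bump (lo hi : ℕ) (b : ℕ →₀ ℝ) : Prop :=
  (∀ j < lo, b j = 0) ∧ (∀ j, hi ≤ j → b j = 0) ∧ S b hi = 0

theorem Bump.disj {l h l' h' : ℕ} {b b' : ℕ →₀ ℝ} (hb : Bump l h b) (hb' : Bump l' h' b')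
    (hh : h ≤ l') (n : ℕ) : S b n = 0 ∨ S b' n = 0 := by
  rcases le_total n l' with h1 | h1
  · right; exact S_lo hb'.1 h1
  · left; rw [S_hi hb.2.1 (hh.trans h1), hb.2.2]

theorem bump_single {i j : ℕ} (h : i < j) :
    Bump i (j + 1) (Finsupp.single i 1 - Finsupp.single j 1) := by
  refine ⟨fun k hk => ?_, fun k hk => ?_, ?_⟩
  · simp [show i ≠ k by omega, show j ≠ k by omega]
  · simp [show i ≠ k by omega, show j ≠ k by omega]
  · rw [S_sub, S_single, S_single, if_pos (by omega), if_pos (by omega), sub_self]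

theorem tail_small (H : Ctx r u) (φ : X →L[ℝ] ℝ) {ε : ℝ} (hε : 0 < ε) :
    ∃ n, ∀ b hi, Bump n hi b →
      |φ (Finsupp.linearCombination ℝ u b)| ≤ ε * ‖Finsupp.linearCombination ℝ u b‖ := by
  by_contra hcon
  push Not at hcon
  have hr := H.hr
  have h1 : ∀ n, ∃ b hi, Bump n hi b ∧ ‖Finsupp.linearCombination ℝ u b‖ ≤ 2 ∧
      ε ≤ φ (Finsupp.linearCombination ℝ u b) := by
    intro n
    obtain ⟨b, hi, hb, h⟩ := hcon n
    have hpos : 0 < ‖Finsupp.linearCombination ℝ u b‖ := by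
      rcases (norm_nonneg (Finsupp.linearCombination ℝ u b)).eq_or_lt with h0 | h0
      · rw [← h0, norm_eq_zero.1 h0.symm] at h
        simp at h
      · exact h0
    have key : ∀ c : ℝ, |c| = 1 → c * φ (Finsupp.linearCombination ℝ u b) =
        |φ (Finsupp.linearCombination ℝ u b)| → ∃ b hi, Bump n hi b ∧
        ‖Finsupp.linearCombination ℝ u b‖ ≤ 2 ∧ ε ≤ φ (Finsupp.linearCombination ℝ u b) := by
      intro c hc hc'
      refine ⟨(c / ‖Finsupp.linearCombination ℝ u b‖) • b, hi, ⟨?_, ?_, ?_⟩, ?_, ?_⟩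
      · intro j hj; simp [hb.1 j hj]
      · intro j hj; simp [hb.2.1 j hj]
      · rw [S_smul, hb.2.2, mul_zero]
      · rw [map_smul, norm_smul, norm_div, Real.norm_eq_abs, hc, norm_norm,
          one_div_mul_cancel hpos.ne']
        norm_num
      · rw [map_smul, map_smul, smul_eq_mul, div_mul_eq_mul_div, hc', le_div_iff₀ hpos]
        exact h.le
    rcases le_total 0 (φ (Finsupp.linearCombination ℝ u b)) with h0 | h0
    · exact key 1 (by simp) (by rw [abs_of_nonneg h0, one_mul])
    · exact key (-1) (by simp) (by rw [abs_of_nonpos h0, neg_one_mul])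
  obtain ⟨f, hf, hf'⟩ := exists_seq_of_forall_finset_exists
    (α := (ℕ →₀ ℝ) × ℕ × ℕ)
    (fun z => Bump z.2.1 z.2.2 z.1 ∧ ‖Finsupp.linearCombination ℝ u z.1‖ ≤ 2 ∧
      ε ≤ φ (Finsupp.linearCombination ℝ u z.1))
    (fun z w => z.2.2 ≤ w.2.1) (by
      intro s _
      obtain ⟨b, hi, hb⟩ := h1 (s.sup fun z => z.2.2)
      exact ⟨(b, _, hi), hb, fun z hz => Finset.le_sup (f := fun z : (ℕ →₀ ℝ) × ℕ × ℕ => z.2.2) hz⟩)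
  obtain ⟨N, hN, hg⟩ := growth hr hε (‖φ‖ ^ r * (2 ^ (r - 1) * 2 ^ r))
  have hu := upper_est H N (fun k => (f k).1) (by
    intro n k l hkl
    rcases lt_or_gt_of_ne hkl with h | h
    · exact (hf k).1.disj (hf l).1 (hf' _ _ h) n
    · exact ((hf l).1.disj (hf k).1 (hf' _ _ h) n).symm) (fun k => (hf k).2.1)
  set x := Finsupp.linearCombination ℝ u (∑ k ∈ Finset.range N, (f k).1) with hx
  have h2 : N * ε ≤ φ x := by
    rw [hx, map_sum, map_sum]
    have := Finset.card_nsmul_le_sum (Finset.range N)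
      (fun k => φ (Finsupp.linearCombination ℝ u (f k).1)) ε (fun k _ => (hf k).2.2)
    simpa using this
  have h3 : N * ε ≤ ‖φ‖ * ‖x‖ := h2.trans ((le_abs_self _).trans (φ.le_opNorm x))
  have h4 : (N * ε) ^ r ≤ ‖φ‖ ^ r * ‖x‖ ^ r := by
    rw [← Real.mul_rpow (norm_nonneg _) (norm_nonneg _)]
    exact Real.rpow_le_rpow (by positivity) h3 (by linarith)
  have h5 : ‖φ‖ ^ r * ‖x‖ ^ r ≤ ‖φ‖ ^ r * (2 ^ (r - 1) * 2 ^ r * N) :=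
    mul_le_mul_of_nonneg_left hu (by positivity)
  have h6 : (N : ℝ) ≤ (N : ℝ) ^ 2 := by
    have : (1 : ℝ) ≤ N := by exact_mod_cast hN
    nlinarith
  have h7 : 0 ≤ ‖φ‖ ^ r * (2 ^ (r - 1) * 2 ^ r) := by positivity
  have := mul_le_mul_of_nonneg_left h6 h7
  nlinarith

end

section
variable {X : Type*} [NormedAddCommGroup X] [NormedSpace ℝ X] {r : ℝ} {u : ℕ → X}

theorem L_eq (u : ℕ → X) (a : ℕ →₀ ℝ) (n : ℕ) (h : ∀ j, n ≤ j → a j = 0) :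
    Finsupp.linearCombination ℝ u a = ∑ i ∈ Finset.range n, a i • u i := by
  rw [Finsupp.linearCombination_apply]
  refine Finsupp.sum_of_support_subset _ (fun j hj => ?_) _ (by simp)
  rw [Finset.mem_range]
  by_contra h'
  exact (Finsupp.mem_support_iff.1 hj) (h j (by omega))

theorem L_inj (H : Ctx r u) : Function.Injective (Finsupp.linearCombination ℝ u) := by
  rw [injective_iff_map_eq_zero]
  intro a ha
  ext i
  have := abs_S_le H a i (i + 1) (Nat.le_succ i)
  rw [ha, norm_zero] at this
  have h0 := abs_nonpos_iff.1 this
  simpa [S, Finset.sum_range_succ] using h0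

theorem exists_functional (H : Ctx r u) (g : (ℕ →₀ ℝ) →ₗ[ℝ] ℝ) (C : ℝ)
    (hg : ∀ a, |g a| ≤ C * ‖Finsupp.linearCombination ℝ u a‖) :
    ∃ φ : X →L[ℝ] ℝ, ∀ a, φ (Finsupp.linearCombination ℝ u a) = g a := by
  let e := LinearEquiv.ofInjective _ (L_inj H)
  let g' : (Finsupp.linearCombination ℝ u).range →L[ℝ] ℝ :=
    LinearMap.mkContinuous (g.comp e.symm.toLinearMap) C (by
      intro y
      obtain ⟨a, rfl⟩ := e.surjective y
      simpa [e] using hg a)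
  obtain ⟨φ, hφ, -⟩ := exists_extension_norm_eq _ g'
  refine ⟨φ, fun a => ?_⟩
  have := hφ (e a)
  simpa [g', e] using this

theorem opNorm_le (H : Ctx r u) (φ : X →L[ℝ] ℝ) (C : ℝ) (hC : 0 ≤ C)
    (h : ∀ a, |φ (Finsupp.linearCombination ℝ u a)| ≤ C * ‖Finsupp.linearCombination ℝ u a‖) :
    ‖φ‖ ≤ C := by
  refine φ.opNorm_le_bound hC (fun x => ?_)
  refine H.dense.induction_on (p := fun x => ‖φ x‖ ≤ C * ‖x‖) x ?_ h
  exact isClosed_le (by fun_prop) (by fun_prop)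

theorem exists_theta (H : Ctx r u) : ∃ θ : (X →L[ℝ] ℝ) →L[ℝ] ℝ,
    ∀ φ : X →L[ℝ] ℝ, Tendsto (fun i => φ (u i)) atTop (𝓝 (θ φ)) := by
  have h : ∀ φ : X →L[ℝ] ℝ, ∃ l, Tendsto (fun i => φ (u i)) atTop (𝓝 l) := by
    intro φ
    refine cauchySeq_tendsto_of_complete (Metric.cauchySeq_iff'.2 (fun ε hε => ?_))
    obtain ⟨n, hn⟩ := tail_small H φ (show 0 < ε / 4 by positivity)
    refine ⟨n, fun m hm => ?_⟩
    rcases hm.eq_or_lt with rfl | hm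
    · simpa using hε
    have h1 := hn _ _ (bump_single hm)
    have h2 := norm_single_sub H n m
    have h3 := h1.trans (mul_le_mul_of_nonneg_left h2 (by positivity))
    rw [map_sub, map_sub, Finsupp.linearCombination_single, Finsupp.linearCombination_single,
      one_smul, one_smul] at h3
    rw [dist_comm, Real.dist_eq]
    linarith
  choose θ hθ using h
  refine ⟨LinearMap.mkContinuous ⟨⟨θ, ?_⟩, ?_⟩ 1 ?_, hθ⟩
  · intro φ ψ
    exact tendsto_nhds_unique (hθ (φ + ψ)) ((hθ φ).add (hθ ψ))
  · intro c φ
    exact tendsto_nhds_unique (hθ (c • φ)) ((hθ φ).const_mul c)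
  · intro φ
    refine le_of_tendsto (hθ φ).norm (Eventually.of_forall fun i => ?_)
    rw [one_mul]
    refine (φ.le_opNorm _).trans ?_
    exact mul_le_of_le_one_right (norm_nonneg _) (norm_u_le H i)

theorem exists_coord (H : Ctx r u) (i : ℕ) : ∃ f : X →L[ℝ] ℝ,
    ∀ a, f (Finsupp.linearCombination ℝ u a) = a i := by
  refine exists_functional H (Finsupp.lapply i) 1 (fun a => ?_)
  have := abs_S_le H a i (i + 1) (Nat.le_succ i)
  simpa [S, Finset.sum_range_succ] using this

theorem exists_total (H : Ctx r u) : ∃ f : X →L[ℝ] ℝ,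
    ∀ a n, (∀ j, n ≤ j → a j = 0) → f (Finsupp.linearCombination ℝ u a) = S a n := by
  have key : ∀ (a : ℕ →₀ ℝ) n, (∀ j, n ≤ j → a j = 0) →
      Finsupp.linearCombination ℝ (fun _ : ℕ => (1 : ℝ)) a = S a n := by
    intro a n h
    rw [L_eq _ a n h]; simp [S]
  obtain ⟨f, hf⟩ := exists_functional H (Finsupp.linearCombination ℝ (fun _ : ℕ => (1 : ℝ))) 1 (by
    intro a
    obtain ⟨n, -, hn⟩ := exists_hi a 0
    rw [key a n hn, one_mul]
    simpa [S] using abs_S_le H a 0 n (Nat.zero_le n))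
  exact ⟨f, fun a n h => by rw [hf, key a n h]⟩

theorem trunc_norm (H : Ctx r u) (f : ℕ → X →L[ℝ] ℝ)
    (hf : ∀ i a, f i (Finsupp.linearCombination ℝ u a) = a i) (φ : X →L[ℝ] ℝ) (n : ℕ) :
    ‖∑ i ∈ Finset.range n, φ (u i) • f i‖ ≤ ‖φ‖ := by
  refine opNorm_le H _ _ (norm_nonneg _) (fun a => ?_)
  have h0 := Finsupp.filter_add_filter_not a (fun j => j < n)
  have ha : ∀ j, n ≤ j → a.filter (fun j => j < n) j = 0 := fun j hj => by
    rw [Finsupp.filter_apply_neg]; omega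
  have h1 := left_le H (a.filter (fun j => j < n)) (a.filter (fun j => ¬ j < n)) n ha
    (fun j hj => by rw [Finsupp.filter_apply_neg]; omega)
  rw [h0] at h1
  have h2 : (∑ i ∈ Finset.range n, φ (u i) • f i) (Finsupp.linearCombination ℝ u a) =
      φ (Finsupp.linearCombination ℝ u (a.filter (fun j => j < n))) := by
    rw [L_eq u _ n ha, map_sum, _root_.sum_apply]
    refine Finset.sum_congr rfl fun i hi => ?_
    rw [Finsupp.filter_apply_pos (fun j => j < n) a (Finset.mem_range.1 hi)]
    simp [hf, mul_comm]
  rw [h2]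
  exact (φ.le_opNorm _).trans (mul_le_mul_of_nonneg_left h1 (norm_nonneg _))

theorem approx (H : Ctx r u) (f : ℕ → X →L[ℝ] ℝ)
    (hf : ∀ i a, f i (Finsupp.linearCombination ℝ u a) = a i) (fi : X →L[ℝ] ℝ)
    (hfi : ∀ a n, (∀ j, n ≤ j → a j = 0) → fi (Finsupp.linearCombination ℝ u a) = S a n)
    (φ : X →L[ℝ] ℝ) (l : ℝ) (hl : Tendsto (fun i => φ (u i)) atTop (𝓝 l)) {ε : ℝ} (hε : 0 < ε) :
    ∃ n, ‖φ - (∑ i ∈ Finset.range n, (φ (u i) - l) • f i + l • fi)‖ ≤ ε := by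
  have hfiu : ∀ i, fi (u i) = 1 := fun i => by
    have := hfi (Finsupp.single i 1) (i + 1) (fun j hj => by simp [show i ≠ j by omega])
    simpa [S_single] using this
  set ψ := φ - l • fi with hψ
  have hψu : ∀ i, ψ (u i) = φ (u i) - l := fun i => by simp [hψ, hfiu]
  have hψ0 : Tendsto (fun i => ψ (u i)) atTop (𝓝 0) := by
    simp only [hψu]
    simpa using hl.sub_const l
  obtain ⟨n, hn⟩ := tail_small H ψ (show 0 < ε / 2 by positivity)
  refine ⟨n, opNorm_le H _ _ hε.le (fun a => ?_)⟩
  have h0 := Finsupp.filter_add_filter_not a (fun j => j < n)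
  set a1 := a.filter (fun j => j < n) with ha1
  set b := a.filter (fun j => ¬ j < n) with hb
  have ha : ∀ j, n ≤ j → a1 j = 0 := fun j hj => by
    rw [ha1, Finsupp.filter_apply_neg]; omega
  have hb0 : ∀ j < n, b j = 0 := fun j hj => by rw [hb, Finsupp.filter_apply_neg]; omega
  have h1 := right_le H a1 b n ha hb0
  rw [h0] at h1
  have h2 : (φ - (∑ i ∈ Finset.range n, (φ (u i) - l) • f i + l • fi))
      (Finsupp.linearCombination ℝ u a) = ψ (Finsupp.linearCombination ℝ u b) := by
    have e1 : ψ (Finsupp.linearCombination ℝ u a1) =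
        (∑ i ∈ Finset.range n, (φ (u i) - l) • f i) (Finsupp.linearCombination ℝ u a) := by
      rw [L_eq u _ n ha, map_sum, _root_.sum_apply]
      refine Finset.sum_congr rfl fun i hi => ?_
      rw [ha1, Finsupp.filter_apply_pos (fun j => j < n) a (Finset.mem_range.1 hi), map_smul, hψu]
      simp [hf, mul_comm]
    have e2 : ψ (Finsupp.linearCombination ℝ u a) = ψ (Finsupp.linearCombination ℝ u a1) +
        ψ (Finsupp.linearCombination ℝ u b) := by rw [← map_add, ← map_add, h0]
    have e3 : ψ (Finsupp.linearCombination ℝ u a) = φ (Finsupp.linearCombination ℝ u a) -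
      l * fi (Finsupp.linearCombination ℝ u a) := by simp [hψ]
    simp only [_root_.sub_apply, _root_.add_apply,
      _root_.smul_apply, smul_eq_mul]
    linarith
  rw [h2]
  refine le_trans ?_ (mul_le_mul_of_nonneg_left h1 hε.le)
  obtain ⟨hi, hnhi, hhi⟩ := exists_hi b n
  set σ := S b hi with hσ
  have hσb : |σ| ≤ ‖Finsupp.linearCombination ℝ u b‖ := by
    have := abs_S_le H b 0 hi (Nat.zero_le _)
    rwa [show S b 0 = 0 by simp [S], sub_zero] at this
  have hm : ∀ m, hi ≤ m → |ψ (Finsupp.linearCombination ℝ u b)| ≤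
      ε * ‖Finsupp.linearCombination ℝ u b‖ + |σ| * |ψ (u m)| := by
    intro m hm
    have hB : Bump n (m + 1) (b - Finsupp.single m σ) := by
      refine ⟨fun j hj => ?_, fun j hj => ?_, ?_⟩
      · simp [hb0 j hj, show m ≠ j by omega]
      · simp [hhi j (by omega), show m ≠ j by omega]
      · rw [S_sub, S_single, if_pos (by omega), S_hi hhi (by omega), sub_self]
    have h3 := hn _ _ hB
    rw [map_sub, Finsupp.linearCombination_single] at h3
    have h4 : ‖Finsupp.linearCombination ℝ u b - σ • u m‖ ≤ 2 * ‖Finsupp.linearCombination ℝ u b‖ := by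
      refine (norm_sub_le _ _).trans ?_
      rw [norm_smul, Real.norm_eq_abs]
      have := mul_le_of_le_one_right (abs_nonneg σ) (norm_u_le H m)
      linarith
    have h5 : ψ (Finsupp.linearCombination ℝ u b) =
        ψ (Finsupp.linearCombination ℝ u b - σ • u m) + σ * ψ (u m) := by
      rw [map_sub, map_smul, smul_eq_mul]; ring
    rw [h5]
    refine (abs_add_le _ _).trans ?_
    rw [abs_mul]
    have := mul_le_mul_of_nonneg_left h4 (show 0 ≤ ε / 2 by positivity)
    linarith
  have hlim : Tendsto (fun m => ε * ‖Finsupp.linearCombination ℝ u b‖ + |σ| * |ψ (u m)|) atTop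
      (𝓝 (ε * ‖Finsupp.linearCombination ℝ u b‖ + |σ| * |0|)) :=
    (hψ0.abs.const_mul _).const_add _
  have := ge_of_tendsto hlim (eventually_atTop.2 ⟨hi, hm⟩)
  simpa using this

theorem bdd_complete [CompleteSpace X] (H : Ctx r u) (t : ℕ → ℝ) (C : ℝ)
    (hC : ∀ n, ‖∑ i ∈ Finset.range n, t i • u i‖ ≤ C) :
    ∃ x, Tendsto (fun n => ∑ i ∈ Finset.range n, t i • u i) atTop (𝓝 x) := by
  have hr := H.hr
  set y := fun n => ∑ i ∈ Finset.range n, t i • u i with hy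
  have hmono : ∀ m n, m ≤ n → ‖y m‖ ^ r + ‖y n - y m‖ ^ r ≤ ‖y n‖ ^ r := by
    intro m n hmn
    let a : ℕ →₀ ℝ := ∑ i ∈ Finset.range m, Finsupp.single i (t i)
    let b : ℕ →₀ ℝ := ∑ i ∈ Finset.Ico m n, Finsupp.single i (t i)
    have ha : Finsupp.linearCombination ℝ u a = y m := by simp [a, hy]
    have hb : Finsupp.linearCombination ℝ u b = y n - y m := by
      simp only [b, hy, map_sum, Finsupp.linearCombination_single]
      rw [Finset.sum_Ico_eq_sub _ hmn]
    have := lower_est H a b m (fun j hj => by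
        simp only [a, Finsupp.finsetSum_apply]
        refine Finset.sum_eq_zero fun i hi => ?_
        rw [Finset.mem_range] at hi
        simp [show i ≠ j by omega]) (fun j hj => by
        simp only [b, Finsupp.finsetSum_apply]
        refine Finset.sum_eq_zero fun i hi => ?_
        rw [Finset.mem_Ico] at hi
        simp [show i ≠ j by omega])
    rw [map_add, ha, hb] at this
    simpa using this
  have hM : Monotone fun n => ‖y n‖ ^ r := by
    intro m n hmn
    have h1 := hmono m n hmn
    have : 0 ≤ ‖y n - y m‖ ^ r := by positivity
    show ‖y m‖ ^ r ≤ ‖y n‖ ^ r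
    linarith
  have hB : BddAbove (Set.range fun n => ‖y n‖ ^ r) := by
    refine ⟨C ^ r, ?_⟩
    rintro _ ⟨n, rfl⟩
    exact Real.rpow_le_rpow (norm_nonneg _) (hC n) (by linarith)
  have hc := (tendsto_atTop_ciSup hM hB).cauchySeq
  refine cauchySeq_tendsto_of_complete (Metric.cauchySeq_iff'.2 (fun ε hε => ?_))
  obtain ⟨N, hN⟩ := Metric.cauchySeq_iff'.1 hc (ε ^ r) (by positivity)
  refine ⟨N, fun n hn => ?_⟩
  have h1 := hmono N n hn
  have h2 := hN n hn
  rw [Real.dist_eq] at h2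
  have h3 := (le_abs_self _).trans_lt h2
  rw [dist_eq_norm]
  refine (Real.rpow_lt_rpow_iff (norm_nonneg _) hε.le (show 0 < r by linarith)).1 ?_
  linarith

theorem bidual [CompleteSpace X] (H : Ctx r u) (f : ℕ → X →L[ℝ] ℝ)
    (hf : ∀ i a, f i (Finsupp.linearCombination ℝ u a) = a i) (fi : X →L[ℝ] ℝ)
    (hfi : ∀ a n, (∀ j, n ≤ j → a j = 0) → fi (Finsupp.linearCombination ℝ u a) = S a n)
    (θ : (X →L[ℝ] ℝ) →L[ℝ] ℝ) (hθ : ∀ φ : X →L[ℝ] ℝ, Tendsto (fun i => φ (u i)) atTop (𝓝 (θ φ)))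
    (F : (X →L[ℝ] ℝ) →L[ℝ] ℝ) :
    ∃ (x : X) (c : ℝ), (∀ φ, F φ = φ x + c * θ φ) ∧
      Tendsto (fun n => ∑ i ∈ Finset.range n, F (f i)) atTop (𝓝 (fi x)) := by
  have hfu : ∀ i j, f i (u j) = if j = i then 1 else 0 := fun i j => by
    have := hf i (Finsupp.single j 1)
    rw [Finsupp.linearCombination_single, one_smul, Finsupp.single_apply] at this
    exact this
  have hfiu : ∀ i, fi (u i) = 1 := fun i => by
    have := hfi (Finsupp.single i 1) (i + 1) (fun j hj => by simp [show i ≠ j by omega])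
    simpa [S_single] using this
  obtain ⟨x, hx⟩ := bdd_complete H (fun i => F (f i)) ‖F‖ (by
    intro n
    obtain ⟨φ, h1, h2⟩ := exists_dual_vector'' ℝ (∑ i ∈ Finset.range n, F (f i) • u i)
    have h3 : φ (∑ i ∈ Finset.range n, F (f i) • u i) = F (∑ i ∈ Finset.range n, φ (u i) • f i) := by
      simp [mul_comm]
    have h4 : ‖∑ i ∈ Finset.range n, F (f i) • u i‖ = F (∑ i ∈ Finset.range n, φ (u i) • f i) := by
      rw [← h3, h2]; rfl
    rw [h4]
    refine (le_abs_self _).trans ((F.le_opNorm _).trans ?_)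
    exact mul_le_of_le_one_right (norm_nonneg _) ((trunc_norm H f hf φ n).trans h1))
  have hfx : ∀ j, f j x = F (f j) := by
    intro j
    refine tendsto_nhds_unique (((f j).continuous.tendsto x).comp hx) ?_
    refine tendsto_const_nhds.congr' ?_
    filter_upwards [eventually_gt_atTop j] with n hn
    simp [hfu, hn]
  have hsum : Tendsto (fun n => ∑ i ∈ Finset.range n, F (f i)) atTop (𝓝 (fi x)) := by
    refine ((fi.continuous.tendsto x).comp hx).congr (fun n => ?_)
    simp [hfiu]
  refine ⟨x, F fi - fi x, fun φ => ?_, hsum⟩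
  have key : ∀ ε > 0, |F φ - φ x - (F fi - fi x) * θ φ| ≤ (‖F‖ + ‖x‖) * ε := by
    intro ε hε
    obtain ⟨n, hn⟩ := approx H f hf fi hfi φ (θ φ) (hθ φ) hε
    set ψ := ∑ i ∈ Finset.range n, (φ (u i) - θ φ) • f i + θ φ • fi with hψ
    have e : F ψ - ψ x = (F fi - fi x) * θ φ := by
      simp only [hψ, map_add, map_sum, map_smul, _root_.add_apply,
        _root_.sum_apply, _root_.smul_apply, hfx, smul_eq_mul]
      ring
    have e2 : F φ - φ x - (F fi - fi x) * θ φ = F (φ - ψ) - (φ - ψ) x := by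
      rw [← e]; simp; ring
    rw [e2]
    refine (abs_sub _ _).trans ?_
    have h1 : |F (φ - ψ)| ≤ ‖F‖ * ε := (F.le_opNorm _).trans (mul_le_mul_of_nonneg_left hn (norm_nonneg _))
    have h2 : |(φ - ψ) x| ≤ ε * ‖x‖ := ((φ - ψ).le_opNorm _).trans (mul_le_mul_of_nonneg_right hn (norm_nonneg _))
    linarith
  have h0 : |F φ - φ x - (F fi - fi x) * θ φ| ≤ 0 := by
    refine le_of_forall_pos_le_add (fun δ hδ => ?_)
    have hp : 0 < ‖F‖ + ‖x‖ + 1 := by positivity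
    have := key (δ / (‖F‖ + ‖x‖ + 1)) (by positivity)
    refine this.trans ?_
    rw [zero_add, ← mul_div_assoc, div_le_iff₀ hp]
    nlinarith [norm_nonneg F, norm_nonneg x]
  have := abs_nonpos_iff.1 h0
  linarith

end

section
variable {X : Type*} [NormedAddCommGroup X] [NormedSpace ℝ X] {r : ℝ} {u : ℕ → X}

theorem double_limit_aux (H : Ctx r u) (θ : (X →L[ℝ] ℝ) →L[ℝ] ℝ)
    (hθ : ∀ φ : X →L[ℝ] ℝ, Tendsto (fun i => φ (u i)) atTop (𝓝 (θ φ)))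
    (T : X →L[ℝ] X →L[ℝ] ℝ) : θ (θ.comp T) ≤ θ (θ.comp T.flip) := by
  by_contra hcon
  push Not at hcon
  have hr := H.hr
  obtain ⟨δ, hδ⟩ : ∃ δ, δ = θ (θ.comp T) - θ (θ.comp T.flip) := ⟨_, rfl⟩
  have hδ0 : 0 < δ := by linarith
  set K : ℝ := 2 ^ (r - 1) * 2 ^ r with hK
  obtain ⟨N, hN, hg⟩ := growth hr (show 0 < δ / 4 by positivity) (‖T‖ ^ r * (K * K))
  have hN' : (0 : ℝ) < N := by exact_mod_cast hN
  obtain ⟨η, hη⟩ : ∃ η : ℝ, η = δ / (4 * N) := ⟨_, rfl⟩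
  have hη0 : 0 < η := by rw [hη]; positivity
  have hlim2 : ∀ x, Tendsto (fun j => T x (u j)) atTop (𝓝 (θ.comp T x)) := fun x => hθ (T x)
  have hlim1 : ∀ y, Tendsto (fun i => T (u i) y) atTop (𝓝 (θ.comp T.flip y)) :=
    fun y => hθ (T.flip y)
  have ev : ∀ {g : ℕ → ℝ} {l : ℝ}, Tendsto g atTop (𝓝 l) → ∀ e > 0, ∀ᶠ i in atTop, |g i - l| ≤ e := by
    intro g l h e he
    filter_upwards [Metric.tendsto_nhds.1 h e he] with i hi
    rw [Real.dist_eq] at hi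
    exact hi.le
  obtain ⟨f, hf, hf'⟩ := exists_seq_of_forall_finset_exists
    (α := ℕ × ℕ × ℕ × ℕ)
    (fun z => z.1 < z.2.1 ∧ z.2.2.1 < z.2.2.2 ∧
      δ / 2 ≤ T (u z.1 - u z.2.1) (u z.2.2.1 - u z.2.2.2))
    (fun z w => z.2.1 + 1 ≤ w.1 ∧ z.2.2.2 + 1 ≤ w.2.2.1 ∧
      |T (u z.1 - u z.2.1) (u w.2.2.1 - u w.2.2.2)| ≤ η ∧
      |T (u w.1 - u w.2.1) (u z.2.2.1 - u z.2.2.2)| ≤ η) (by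
      intro s _
      let A : ℕ → Prop := fun i => ∀ z ∈ s, z.2.1 + 1 ≤ i ∧
        |T (u i) (u z.2.2.1 - u z.2.2.2) - θ.comp T.flip (u z.2.2.1 - u z.2.2.2)| ≤ η / 2
      let A' : ℕ → Prop := fun j => ∀ z ∈ s, z.2.2.2 + 1 ≤ j ∧
        |T (u z.1 - u z.2.1) (u j) - θ.comp T (u z.1 - u z.2.1)| ≤ η / 2
      have hA : ∀ᶠ i in atTop, A i := by
        refine (Filter.eventually_all_finset s).2 (fun z _ => ?_)
        exact (eventually_ge_atTop _).and (ev (hlim1 _) _ (by positivity))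
      have hA' : ∀ᶠ i in atTop, A' i := by
        refine (Filter.eventually_all_finset s).2 (fun z _ => ?_)
        exact (eventually_ge_atTop _).and (ev (hlim2 _) _ (by positivity))
      have hd : 0 < δ / 16 := by positivity
      obtain ⟨i, hi⟩ := hA.exists
      obtain ⟨j, hj, hj1, hj2⟩ := (hA'.and ((ev (hlim2 (u i)) _ hd).and
        (ev (hθ (θ.comp T.flip)) _ hd))).exists
      obtain ⟨i', hi', hii, hi1, hi2⟩ := (hA.and ((eventually_gt_atTop i).and
        ((ev (hlim1 (u j)) _ hd).and (ev (hθ (θ.comp T)) _ hd)))).exists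
      obtain ⟨j', hj', hjj, hj3, hj4⟩ := (hA'.and ((eventually_gt_atTop j).and
        ((ev (hlim2 (u i)) _ hd).and (ev (hlim2 (u i')) _ hd)))).exists
      refine ⟨(i, i', j, j'), ⟨hii, hjj, ?_⟩, fun z hz => ⟨(hi z hz).1, (hj z hz).1, ?_, ?_⟩⟩
      · simp only [map_sub, _root_.sub_apply]
        rw [abs_le] at hj1 hj2 hi1 hi2 hj3 hj4
        linarith [hj1.1, hj1.2, hj2.1, hj2.2, hi1.1, hi1.2, hi2.1, hi2.2, hj3.1, hj3.2, hj4.1, hj4.2]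
      · have h1 := (hj z hz).2
        have h2 := (hj' z hz).2
        rw [map_sub]
        rw [abs_le] at h1 h2 ⊢
        constructor <;> linarith [h1.1, h1.2, h2.1, h2.2]
      · have h1 := (hi z hz).2
        have h2 := (hi' z hz).2
        rw [map_sub T, _root_.sub_apply]
        rw [abs_le] at h1 h2 ⊢
        constructor <;> linarith [h1.1, h1.2, h2.1, h2.2])
  have e : ∀ i j, Finsupp.linearCombination ℝ u (Finsupp.single i 1 - Finsupp.single j 1) =
      u i - u j := fun i j => by simp
  have hx := upper_est H N
    (fun k => Finsupp.single (f k).1 1 - Finsupp.single (f k).2.1 1) (by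
    intro n k l hkl
    rcases lt_or_gt_of_ne hkl with h | h
    · exact (bump_single (hf k).1).disj (bump_single (hf l).1) (hf' _ _ h).1 n
    · exact ((bump_single (hf l).1).disj (bump_single (hf k).1) (hf' _ _ h).1 n).symm)
    (fun k => norm_single_sub H _ _)
  have hy := upper_est H N
    (fun k => Finsupp.single (f k).2.2.1 1 - Finsupp.single (f k).2.2.2 1) (by
    intro n k l hkl
    rcases lt_or_gt_of_ne hkl with h | h
    · exact (bump_single (hf k).2.1).disj (bump_single (hf l).2.1) (hf' _ _ h).2.1 n
    · exact ((bump_single (hf l).2.1).disj (bump_single (hf k).2.1) (hf' _ _ h).2.1 n).symm)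
    (fun k => norm_single_sub H _ _)
  simp only [map_sum, e] at hx hy
  set x := ∑ k ∈ Finset.range N, (u (f k).1 - u (f k).2.1) with hxd
  set y := ∑ k ∈ Finset.range N, (u (f k).2.2.1 - u (f k).2.2.2) with hyd
  have hTxy : T x y = ∑ k ∈ Finset.range N, ∑ l ∈ Finset.range N,
      T (u (f k).1 - u (f k).2.1) (u (f l).2.2.1 - u (f l).2.2.2) := by
    rw [hxd, map_sum T, _root_.sum_apply]
    refine Finset.sum_congr rfl fun k _ => ?_
    rw [hyd, map_sum]
  have hterm : ∀ k l, (if k = l then δ / 2 else 0) - η ≤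
      T (u (f k).1 - u (f k).2.1) (u (f l).2.2.1 - u (f l).2.2.2) := by
    intro k l
    rcases lt_trichotomy k l with h | h | h
    · rw [if_neg h.ne]
      have := (abs_le.1 (hf' _ _ h).2.2.1).1
      linarith
    · subst h
      rw [if_pos rfl]
      linarith [(hf k).2.2]
    · rw [if_neg h.ne']
      have := (abs_le.1 (hf' _ _ h).2.2.2).1
      linarith
  have hlow : N * (δ / 4) ≤ T x y := by
    rw [hTxy]
    calc N * (δ / 4) = ∑ k ∈ Finset.range N, ∑ l ∈ Finset.range N,
          ((if k = l then δ / 2 else 0) - η) := by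
          have : ∀ k ∈ Finset.range N, ∑ l ∈ Finset.range N,
              ((if k = l then δ / 2 else 0) - η) = δ / 2 - N * η := by
            intro k hk
            rw [Finset.sum_sub_distrib, Finset.sum_ite_eq, if_pos hk]
            simp
          rw [Finset.sum_congr rfl this, hη]
          simp
          field_simp
          ring
      _ ≤ _ := Finset.sum_le_sum fun k _ => Finset.sum_le_sum fun l _ => hterm k l
  have h3 : N * (δ / 4) ≤ ‖T‖ * ‖x‖ * ‖y‖ := hlow.trans ((le_abs_self _).trans (T.le_opNorm₂ x y))
  have h4 : (N * (δ / 4)) ^ r ≤ ‖T‖ ^ r * ‖x‖ ^ r * ‖y‖ ^ r := by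
    have hh := Real.rpow_le_rpow (by positivity) h3 (by linarith : (0:ℝ) ≤ r)
    have e1 : (‖T‖ * ‖x‖ * ‖y‖) ^ r = (‖T‖ * ‖x‖) ^ r * ‖y‖ ^ r :=
      Real.mul_rpow (by positivity) (by positivity)
    have e2 : (‖T‖ * ‖x‖) ^ r = ‖T‖ ^ r * ‖x‖ ^ r :=
      Real.mul_rpow (by positivity) (by positivity)
    rwa [e1, e2] at hh
  have h5 : ‖T‖ ^ r * ‖x‖ ^ r * ‖y‖ ^ r ≤ ‖T‖ ^ r * (K * N) * (K * N) := by
    gcongr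
  have h6 : ‖T‖ ^ r * (K * N) * (K * N) = ‖T‖ ^ r * (K * K) * (N : ℝ) ^ 2 := by ring
  linarith

theorem double_limit (H : Ctx r u) (θ : (X →L[ℝ] ℝ) →L[ℝ] ℝ)
    (hθ : ∀ φ : X →L[ℝ] ℝ, Tendsto (fun i => φ (u i)) atTop (𝓝 (θ φ)))
    (T : X →L[ℝ] X →L[ℝ] ℝ) : θ (θ.comp T) = θ (θ.comp T.flip) := by
  refine le_antisymm (double_limit_aux H θ hθ T) ?_
  have := double_limit_aux H θ hθ T.flip
  rwa [ContinuousLinearMap.flip_flip] at this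

theorem main [CompleteSpace X] (H : Ctx r u) : PropertyW X ∧ ¬ WeaklySeqComplete (X →L[ℝ] ℝ) := by
  obtain ⟨θ, hθ⟩ := exists_theta H
  choose f hf using exists_coord H
  obtain ⟨fi, hfi⟩ := exists_total H
  have hbi := bidual H f hf fi hfi θ hθ
  have hfu : ∀ i j, f i (u j) = if j = i then 1 else 0 := fun i j => by
    have := hf i (Finsupp.single j 1)
    rw [Finsupp.linearCombination_single, one_smul, Finsupp.single_apply] at this
    exact this
  constructor
  · intro T
    refine weakly_compact_of T (fun ξ => ?_)
    obtain ⟨x, c, hx, -⟩ := hbi ξ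
    refine ⟨T x + c • θ.comp T.flip, fun F => ?_⟩
    obtain ⟨y, d, hy, -⟩ := hbi F
    have h1 : F (θ.comp T.flip) = θ (F.comp T) := by
      have : F.comp T = T.flip y + d • θ.comp T := by
        ext z
        simp [hy]
      rw [this, hy, map_add, map_smul, double_limit H θ hθ T]
      simp
    rw [hx, map_add, map_smul, h1]
    simp
  · intro hw
    obtain ⟨g, hg⟩ := hw (fun n => ∑ i ∈ Finset.range n, f i) (fun F => by
      obtain ⟨x, c, -, h⟩ := hbi F
      refine ⟨fi x, ?_⟩
      simpa using h)
    have hgu : ∀ j, g (u j) = 1 := by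
      intro j
      refine tendsto_nhds_unique (hg (NormedSpace.inclusionInDoubleDual ℝ X (u j))) ?_
      refine tendsto_const_nhds.congr' ?_
      filter_upwards [eventually_gt_atTop j] with n hn
      simp [hfu, hn]
    have h1 : θ g = 1 := by
      refine tendsto_nhds_unique (hθ g) ?_
      simp [hgu]
    have h0 : ∀ i, θ (f i) = 0 := by
      intro i
      refine tendsto_nhds_unique (hθ (f i)) ?_
      refine tendsto_const_nhds.congr' ?_
      filter_upwards [eventually_gt_atTop i] with n hn
      simp [hfu, show n ≠ i by omega]
    have h2 := hg θ
    simp only [map_sum, h0, Finset.sum_const_zero, h1] at h2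
    exact zero_ne_one (tendsto_nhds_unique tendsto_const_nhds h2)

end

end JT

open scoped ENNReal in
/-- Corollary 4 of the paper. -/
theorem statement3 (p : ℝ≥0∞) [Fact (1 ≤ p)] (hp2 : (2 : ℝ≥0∞) < p) (hp' : p < ⊤)
    {X : Type*} [NormedAddCommGroup X] [NormedSpace ℝ X] [CompleteSpace X]
    (u : ℕ → X)
    (hJ : IsJamesSpace (fun i => (lp.single p i 1 : lp (fun _ : ℕ => ℝ) p)) u) :
    PropertyW X ∧ ¬ WeaklySeqComplete (X →L[ℝ] ℝ) := by
  have hn := JT.norm_facts p hp2 hp' u hJ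
  refine JT.main (r := p.toReal) (u := u) ⟨?_, ?_, hn.1, hn.2⟩
  · rw [← ENNReal.toReal_ofNat 2]
    exact (ENNReal.toReal_lt_toReal (by simp) hp'.ne).2 hp2
  · have h := hJ.1
    rw [← Finsupp.range_linearCombination] at h
    rw [LinearMap.coe_range] at h
    exact h
end

section
/- There exists a Banach space X such that every bounded linear operator from X into its dual X' is weakly compact, but X' is not weakly sequentially complete. -/
open Filter Topology

noncomputable section
open scoped ENNReal

def IsPart (F : Finset (ℕ × ℕ)) : Prop :=
  (∀ p ∈ F, p.1 < p.2) ∧ ∀ p ∈ F, ∀ q ∈ F, ∀ n, p.1 ≤ n → n < p.2 → q.1 ≤ n → n < q.2 → p = q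

def VV (F : Finset (ℕ × ℕ)) (y : ℕ → ℝ) : ℝ := ∑ p ∈ F, (y p.2 - y p.1) ^ 4

def trunc (n m : ℕ) (y : ℕ → ℝ) : ℕ → ℝ := fun k => if n < k ∧ k ≤ m then y k else 0

theorem IsPart.filter {F : Finset (ℕ × ℕ)} (h : IsPart F) (P : ℕ × ℕ → Prop) [DecidablePred P] :
    IsPart (F.filter P) :=
  ⟨fun p hp => h.1 p (Finset.mem_filter.1 hp).1, fun p hp q hq =>
    h.2 p (Finset.mem_filter.1 hp).1 q (Finset.mem_filter.1 hq).1⟩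

theorem IsPart.card {F : Finset (ℕ × ℕ)} (h : IsPart F) (n : ℕ) :
    (F.filter (fun p => p.1 ≤ n ∧ n < p.2)).card ≤ 1 := by
  rw [Finset.card_le_one]
  intro a ha b hb
  simp only [Finset.mem_filter] at ha hb
  exact h.2 a ha.1 b hb.1 n ha.2.1 ha.2.2 hb.2.1 hb.2.2

theorem VV_nonneg (F : Finset (ℕ × ℕ)) (y : ℕ → ℝ) : 0 ≤ VV F y :=
  Finset.sum_nonneg fun _ _ => by positivity

theorem VV_trunc {F : Finset (ℕ × ℕ)} (h : IsPart F) (n m : ℕ) (y : ℕ → ℝ) (B : ℝ)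
    (hB0 : 0 ≤ B) (hB : ∀ k, n < k → (y k) ^ 4 ≤ B) :
    VV F (trunc n m y) ≤ VV (F.filter (fun p => n < p.1)) y + 2 * B := by
  have key : ∀ p ∈ F, (trunc n m y p.2 - trunc n m y p.1) ^ 4 ≤
      (if n < p.1 then (y p.2 - y p.1) ^ 4 else 0) +
      ((if p.1 ≤ n ∧ n < p.2 then B else 0) + (if p.1 ≤ m ∧ m < p.2 then B else 0)) := by
    intro p hp
    have hlt := h.1 p hp
    have e1 : 0 ≤ (if n < p.1 then (y p.2 - y p.1) ^ 4 else 0) := by split_ifs <;> positivity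
    have e2 : 0 ≤ (if p.1 ≤ n ∧ n < p.2 then B else 0) := by split_ifs <;> positivity
    have e3 : 0 ≤ (if p.1 ≤ m ∧ m < p.2 then B else 0) := by split_ifs <;> positivity
    by_cases ha : n < p.1 ∧ p.1 ≤ m <;> by_cases hb : n < p.2 ∧ p.2 ≤ m
    · simp only [trunc, if_pos ha, if_pos hb]
      rw [if_pos ha.1] at *
      linarith
    · have h2 : p.1 ≤ m ∧ m < p.2 := by omega
      simp only [trunc, if_pos ha, if_neg hb]
      rw [if_pos h2]
      have := hB p.1 ha.1
      have : (0 - y p.1) ^ 4 = y p.1 ^ 4 := by ring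
      linarith
    · have h2 : p.1 ≤ n ∧ n < p.2 := by omega
      simp only [trunc, if_neg ha, if_pos hb]
      rw [if_pos h2]
      have := hB p.2 hb.1
      have : (y p.2 - 0) ^ 4 = y p.2 ^ 4 := by ring
      linarith
    · simp only [trunc, if_neg ha, if_neg hb]
      have : ((0:ℝ) - 0) ^ 4 = 0 := by norm_num
      linarith
  have hc : ∀ n, ∑ p ∈ F, (if p.1 ≤ n ∧ n < p.2 then B else 0) ≤ B := by
    intro n
    rw [← Finset.sum_filter, Finset.sum_const, nsmul_eq_mul]
    have : ((F.filter (fun p => p.1 ≤ n ∧ n < p.2)).card : ℝ) ≤ 1 := by exact_mod_cast h.card n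
    nlinarith
  have := Finset.sum_le_sum key
  rw [Finset.sum_add_distrib, Finset.sum_add_distrib] at this
  have h1 := hc n
  have h2 := hc m
  unfold VV
  rw [Finset.sum_filter]
  linarith

abbrev PartT := {F : Finset (ℕ × ℕ) // IsPart F}

instance fact4 : Fact ((1:ℝ≥0∞) ≤ 4) := ⟨by norm_num⟩

abbrev BF (F : PartT) := PiLp 4 (fun _ : F.1 => ℝ)

abbrev Big := lp BF ∞

theorem BF_norm (F : PartT) (v : BF F) : ‖v‖ ^ 4 = ∑ p, (v p) ^ 4 := by
  have h := PiLp.norm_eq_sum (p := 4) (by norm_num) v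
  rw [h]
  have h4 : (4:ℝ≥0∞).toReal = 4 := by norm_num
  rw [h4, ← Real.rpow_natCast, ← Real.rpow_mul]
  · norm_num
    refine Finset.sum_congr rfl fun p _ => ?_
    have : |v p| ^ (4:ℝ) = |v p| ^ (4:ℕ) := by
      rw [← Real.rpow_natCast]; norm_num
    first
      | rw [this, (by decide : Even 4).pow_abs]
      | (rw [(by decide : Even 4).pow_abs])
  · exact Finset.sum_nonneg fun _ _ => Real.rpow_nonneg (norm_nonneg _) _

theorem Big_norm (g : Big) (C : ℝ) (hC : 0 ≤ C) :
    ‖g‖ ≤ C ↔ ∀ F : PartT, ∑ p, (g F p) ^ 4 ≤ C ^ 4 := by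
  constructor
  · intro h F
    rw [← BF_norm]
    exact pow_le_pow_left₀ (norm_nonneg _)
      ((lp.norm_apply_le_norm ENNReal.top_ne_zero g F).trans h) 4
  · intro h
    refine lp.norm_le_of_forall_le hC fun F => ?_
    have := h F
    rw [← BF_norm] at this
    exact le_of_pow_le_pow_left₀ (by norm_num) hC this

def bigOf (y : ℕ → ℝ) (C : ℝ) (h : ∀ F, IsPart F → VV F y ≤ C) : Big :=
  ⟨fun F => WithLp.toLp 4 (fun p => y p.1.2 - y p.1.1), by
    refine memℓp_infty ⟨1 + C, ?_⟩
    rintro _ ⟨F, rfl⟩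
    have h1 := h F.1 F.2
    have h0 := (VV_nonneg F.1 y).trans h1
    refine le_of_pow_le_pow_left₀ (n := 4) (by norm_num) (by linarith) ?_
    rw [BF_norm]
    have : ∑ p : F.1, (y p.1.2 - y p.1.1) ^ 4 = VV F.1 y :=
      Finset.sum_coe_sort F.1 (fun p => (y p.2 - y p.1) ^ 4)
    simp only
    rw [this]
    refine h1.trans ?_
    have : 1 ≤ (1 + C) ^ 3 := one_le_pow₀ (by linarith)
    have : (1 + C) ^ 4 = (1 + C) ^ 3 * (1 + C) := by ring
    nlinarith⟩

theorem bigOf_apply (y C h) (F : PartT) (p : F.1) : bigOf y C h F p = y p.1.2 - y p.1.1 := rfl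

theorem part_single (n : ℕ) (h : 0 < n) : IsPart {(0, n)} := by
  constructor
  · intro p hp; simp at hp; subst hp; exact h
  · intro p hp q hq; simp at hp hq; subst hp; subst hq; intros; rfl

def coord (n : ℕ) : Big →L[ℝ] ℝ :=
  if h : 0 < n then
    LinearMap.mkContinuous
      { toFun := fun g => g ⟨{(0, n)}, part_single n h⟩ ⟨(0, n), by simp⟩
        map_add' := fun _ _ => rfl
        map_smul' := fun _ _ => rfl } 1 (fun g => by
          rw [one_mul]
          exact (PiLp.norm_apply_le _ _).trans (lp.norm_apply_le_norm ENNReal.top_ne_zero g _))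
  else 0

theorem coord_bigOf (y C h) (n : ℕ) (hy : y 0 = 0) : coord n (bigOf y C h) = y n := by
  unfold coord
  split_ifs with h0
  · change y n - y 0 = _
    rw [hy, sub_zero]
  · have : n = 0 := by omega
    simp [this, hy]

def ent (F : PartT) (p : F.1) : Big →L[ℝ] ℝ :=
    LinearMap.mkContinuous
      { toFun := fun g => g F p
        map_add' := fun _ _ => rfl
        map_smul' := fun _ _ => rfl } 1 (fun g => by
          rw [one_mul]
          exact (PiLp.norm_apply_le _ _).trans (lp.norm_apply_le_norm ENNReal.top_ne_zero g _))

def sg (k n : ℕ) : ℝ := if n = k + 1 then 1 else 0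

theorem sg_eq (k : ℕ) : sg k = trunc k (k+1) (fun _ => 1) := by
  funext n
  simp only [sg, trunc]
  congr 1
  simp only [eq_iff_iff]
  omega

theorem sg_bd (k : ℕ) (F) (hF : IsPart F) : VV F (sg k) ≤ 2 := by
  rw [sg_eq]
  refine (VV_trunc hF _ _ _ 1 (by norm_num) (by simp)).trans ?_
  simp [VV]

def be (k : ℕ) : Big := bigOf (sg k) 2 (sg_bd k)

structure JS (X : Type) [NormedAddCommGroup X] [NormedSpace ℝ X] where
  e : ℕ → X
  c : ℕ → X →L[ℝ] ℝ
  c_zero : c 0 = 0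
  c_e : ∀ n k, c n (e k) = if n = k + 1 then 1 else 0
  dense : (Submodule.span ℝ (Set.range e)).topologicalClosure = ⊤
  norm_iff : ∀ (x : X) (C : ℝ), 0 ≤ C → (‖x‖ ≤ C ↔ ∀ F, IsPart F → VV F (fun n => c n x) ≤ C ^ 4)

abbrev XX := (Submodule.span ℝ (Set.range be)).topologicalClosure

theorem ent_coord (F : PartT) (p : F.1) (g : Big) (hg : g ∈ XX) :
    ent F p g = coord p.1.2 g - coord p.1.1 g := by
  have : XX ≤ LinearMap.ker ((ent F p - (coord p.1.2 - coord p.1.1) : Big →L[ℝ] ℝ) : Big →ₗ[ℝ] ℝ) := by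
    refine Submodule.topologicalClosure_minimal _ ?_ (ContinuousLinearMap.isClosed_ker _)
    rw [Submodule.span_le]
    rintro _ ⟨k, rfl⟩
    simp only [SetLike.mem_coe, LinearMap.mem_ker]
    change ent F p (be k) - (coord p.1.2 (be k) - coord p.1.1 (be k)) = 0
    rw [be, coord_bigOf _ _ _ _ (by simp [sg]), coord_bigOf _ _ _ _ (by simp [sg])]
    change (sg k p.1.2 - sg k p.1.1) - _ = 0
    ring
  have h := this hg
  simp only [LinearMap.mem_ker] at h
  change ent F p g - (coord p.1.2 g - coord p.1.1 g) = 0 at h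
  linarith

def theJS : JS XX where
  e k := ⟨be k, Submodule.le_topologicalClosure _ (Submodule.subset_span ⟨k, rfl⟩)⟩
  c n := (coord n).comp XX.subtypeL
  c_zero := by ext x; simp [coord]
  c_e n k := by
    change coord n (be k) = _
    rw [be, coord_bigOf _ _ _ _ (by simp [sg])]
    rfl
  dense := by
    rw [Submodule.eq_top_iff']
    rintro ⟨x, hx⟩
    have hx' : x ∈ closure (Submodule.span ℝ (Set.range be) : Set Big) := hx
    change _ ∈ closure _
    rw [closure_subtype]
    refine closure_mono ?_ hx'
    intro y hy
    refine ⟨⟨y, Submodule.le_topologicalClosure _ hy⟩, ?_, rfl⟩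
    simp only [SetLike.mem_coe]
    have : Submodule.map XX.subtype (Submodule.span ℝ (Set.range fun k => (⟨be k, Submodule.le_topologicalClosure _ (Submodule.subset_span ⟨k, rfl⟩)⟩ : XX))) = Submodule.span ℝ (Set.range be) := by
      rw [Submodule.map_span, ← Set.range_comp]
      rfl
    have hy2 : y ∈ Submodule.span ℝ (Set.range be) := hy
    rw [← this] at hy2
    obtain ⟨z, hz, rfl⟩ := hy2
    exact hz
  norm_iff x C hC := by
    change ‖(x : Big)‖ ≤ C ↔ _
    rw [Big_norm _ _ hC]
    have : ∀ F : PartT, ∑ p, ((x : Big) F p) ^ 4 = VV F.1 (fun n => coord n x) := by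
      intro F
      refine Eq.trans (Finset.sum_congr rfl fun p _ => ?_)
        (Finset.sum_coe_sort F.1 (fun p => (coord p.2 x - coord p.1 x) ^ 4))
      rw [← ent_coord F p x x.2]
      rfl
    simp only [this]
    exact ⟨fun h F hF => h ⟨F, hF⟩, fun h F => h F.1 F.2⟩

theorem XX_complete : CompleteSpace XX :=
  (Submodule.isClosed_topologicalClosure (Submodule.span ℝ (Set.range be))).completeSpace_coe

theorem inner_le_nonneg_pow (S : Finset ℕ) (d : ℕ → ℝ) (hc : S.card ≤ 2) :
    (∑ k ∈ S, d k) ^ 4 ≤ 8 * ∑ k ∈ S, d k ^ 4 := by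
  have h : S.card = 0 ∨ S.card = 1 ∨ S.card = 2 := by omega
  rcases h with h | h | h
  · rw [Finset.card_eq_zero] at h; simp [h]
  · obtain ⟨a, rfl⟩ := Finset.card_eq_one.1 h
    simp only [Finset.sum_singleton]
    have : 0 ≤ d a ^ 4 := by positivity
    linarith
  · obtain ⟨a, b, hab, rfl⟩ := Finset.card_eq_two.1 h
    rw [Finset.sum_pair hab, Finset.sum_pair hab]
    have h1 : (d a + d b) ^ 2 ≤ 2 * (d a ^ 2 + d b ^ 2) := by nlinarith [sq_nonneg (d a - d b)]
    have h2 : (d a ^ 2 + d b ^ 2) ^ 2 ≤ 2 * (d a ^ 4 + d b ^ 4) := by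
      nlinarith [sq_nonneg (d a ^ 2 - d b ^ 2)]
    have h3 : ((d a + d b) ^ 2) ^ 2 ≤ (2 * (d a ^ 2 + d b ^ 2)) ^ 2 :=
      pow_le_pow_left₀ (by positivity) h1 2
    nlinarith

namespace JS

variable {X : Type} [NormedAddCommGroup X] [NormedSpace ℝ X] (J : JS X)

theorem VV_le (x : X) (F) (hF : IsPart F) : VV F (fun n => J.c n x) ≤ ‖x‖ ^ 4 :=
  (J.norm_iff x ‖x‖ (norm_nonneg _)).1 le_rfl F hF

theorem c_pow_le (n : ℕ) (x : X) : (J.c n x) ^ 4 ≤ ‖x‖ ^ 4 := by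
  rcases Nat.eq_zero_or_pos n with h | h
  · subst h; rw [J.c_zero]; simp
  · have := J.VV_le x _ (part_single n h)
    simpa [VV, J.c_zero] using this

theorem abs_c_le (n : ℕ) (x : X) : |J.c n x| ≤ ‖x‖ := by
  refine le_of_pow_le_pow_left₀ (n := 4) (by norm_num) (norm_nonneg _) ?_
  rw [(by decide : Even 4).pow_abs]
  exact J.c_pow_le n x

/-- finite combination -/
def blk (y : ℕ → ℝ) (n m : ℕ) : X := ∑ i ∈ Finset.Ico n m, y (i + 1) • J.e i

theorem c_blk (y : ℕ → ℝ) (n m k : ℕ) : J.c k (J.blk y n m) = trunc n m y k := by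
  unfold blk trunc
  simp only [map_sum, map_smul, J.c_e, smul_eq_mul, mul_ite, mul_one, mul_zero]
  split_ifs with h
  · rw [Finset.sum_eq_single (k - 1)]
    · have : k = k - 1 + 1 := by omega
      rw [if_pos this, ← this]
    · intro b _ hb
      rw [if_neg (by omega)]
    · intro hk
      simp only [Finset.mem_Ico] at hk
      omega
  · refine Finset.sum_eq_zero fun i hi => ?_
    simp only [Finset.mem_Ico] at hi
    rw [if_neg (by omega)]

theorem blk_norm (y : ℕ → ℝ) (n m : ℕ) (B C : ℝ) (hB0 : 0 ≤ B) (hC : 0 ≤ C)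
    (hB : ∀ k, n < k → (y k) ^ 4 ≤ B)
    (hV : ∀ F, IsPart F → (∀ p ∈ F, n < p.1) → VV F y + 2 * B ≤ C ^ 4) :
    ‖J.blk y n m‖ ≤ C := by
  rw [J.norm_iff _ _ hC]
  intro F hF
  simp only [c_blk]
  refine (VV_trunc hF n m y B hB0 hB).trans (hV _ (hF.filter _) ?_)
  intro p hp
  exact (Finset.mem_filter.1 hp).2

/-- the block projection -/
def P (n m : ℕ) : X →L[ℝ] X :=
  ∑ i ∈ Finset.Ico n m, (J.c (i + 1)).smulRight (J.e i)

theorem P_apply (n m : ℕ) (x : X) : J.P n m x = J.blk (fun k => J.c k x) n m := by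
  simp [P, blk]

theorem P_norm (n m : ℕ) (x : X) : ‖J.P n m x‖ ≤ 2 * ‖x‖ := by
  rw [P_apply]
  refine J.blk_norm _ n m (‖x‖ ^ 4) _ (by positivity) (by positivity)
    (fun k _ => J.c_pow_le k x) ?_
  intro F hF _
  have := J.VV_le x F hF
  have h2 : (2 * ‖x‖) ^ 4 = 16 * ‖x‖ ^ 4 := by ring
  have : 0 ≤ ‖x‖ ^ 4 := by positivity
  linarith

def v (n : ℕ) : X := J.blk (fun _ => 1) 0 n

theorem blk_one_norm (n m : ℕ) : ‖J.blk (fun _ => 1) n m‖ ≤ 2 := by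
  refine J.blk_norm _ n m 1 _ (by positivity) (by positivity) (by simp) ?_
  intro F hF _
  simp [VV]; norm_num

theorem v_sub (n m : ℕ) (h : n ≤ m) : J.v m - J.v n = J.blk (fun _ => 1) n m := by
  unfold v blk
  rw [sub_eq_iff_eq_add, add_comm, Finset.sum_Ico_consecutive _ (Nat.zero_le _) h]

theorem ext_c {x y : X} (h : ∀ n, J.c n x = J.c n y) : x = y := by
  rw [← sub_eq_zero, ← norm_le_zero_iff, J.norm_iff _ _ le_rfl]
  intro F _
  simp [VV, h]

theorem tendsto_P (x : X) : Tendsto (fun m => J.P 0 m x) atTop (𝓝 x) := by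
  have hspan : ∀ s ∈ Submodule.span ℝ (Set.range J.e), ∃ N, ∀ m ≥ N, J.P 0 m s = s := by
    intro s hs
    induction hs using Submodule.span_induction with
    | mem x hx =>
      obtain ⟨k, rfl⟩ := hx
      refine ⟨k + 1, fun m hm => J.ext_c fun n => ?_⟩
      rw [P_apply, c_blk, trunc, J.c_e]
      split_ifs <;> first | rfl | omega
    | zero => exact ⟨0, fun m _ => map_zero _⟩
    | add x y _ _ hx hy =>
      obtain ⟨N, hN⟩ := hx
      obtain ⟨M, hM⟩ := hy
      refine ⟨max N M, fun m hm => ?_⟩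
      rw [map_add, hN m (le_trans (le_max_left _ _) hm), hM m (le_trans (le_max_right _ _) hm)]
    | smul a x _ hx =>
      obtain ⟨N, hN⟩ := hx
      exact ⟨N, fun m hm => by rw [map_smul, hN m hm]⟩
  rw [Metric.tendsto_atTop]
  intro ε hε
  have hx : x ∈ closure (Submodule.span ℝ (Set.range J.e) : Set X) := by
    have : x ∈ (Submodule.span ℝ (Set.range J.e)).topologicalClosure := by rw [J.dense]; trivial
    exact this
  obtain ⟨s, hs, hd⟩ := Metric.mem_closure_iff.1 hx (ε / 4) (by positivity)
  obtain ⟨N, hN⟩ := hspan s hs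
  refine ⟨N, fun m hm => ?_⟩
  rw [dist_eq_norm] at *
  have h1 : J.P 0 m x - x = J.P 0 m (x - s) - (x - s) := by rw [map_sub, hN m hm]; abel
  rw [h1]
  have := norm_sub_le (J.P 0 m (x - s)) (x - s)
  have := J.P_norm 0 m (x - s)
  linarith

/-- upper 4-estimate -/
theorem upper (N : ℕ) (z : ℕ → X) (M : ℝ) (hM : 0 ≤ M) (hz : ∀ k, ‖z k‖ ≤ M)
    (hd : ∀ k l n, J.c n (z k) ≠ 0 → J.c n (z l) ≠ 0 → k = l) :
    ‖∑ k ∈ Finset.range N, z k‖ ^ 4 ≤ 8 * N * M ^ 4 := by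
  have hpt : ∀ n m : ℕ, (∑ k ∈ Finset.range N, (J.c m (z k) - J.c n (z k))) ^ 4 ≤
      8 * ∑ k ∈ Finset.range N, (J.c m (z k) - J.c n (z k)) ^ 4 := by
    intro n m
    set d : ℕ → ℝ := fun k => J.c m (z k) - J.c n (z k) with hdd
    set S := (Finset.range N).filter (fun k => d k ≠ 0) with hS
    have e1 : ∑ k ∈ Finset.range N, d k = ∑ k ∈ S, d k :=
      (Finset.sum_filter_ne_zero _).symm
    have e2 : ∑ k ∈ S, d k ^ 4 ≤ ∑ k ∈ Finset.range N, d k ^ 4 :=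
      Finset.sum_le_sum_of_subset_of_nonneg (Finset.filter_subset _ _)
        (fun _ _ _ => by positivity)
    have hc : S.card ≤ 2 := by
      by_contra! hc
      obtain ⟨a, b, c, ha, hb, hc, hab, hac, hbc⟩ := Finset.two_lt_card_iff.1 hc
      have key : ∀ k ∈ S, J.c m (z k) ≠ 0 ∨ J.c n (z k) ≠ 0 := by
        intro k hk
        by_contra! h
        exact (Finset.mem_filter.1 hk).2 (by simp [hdd, h.1, h.2])
      rcases key a ha with h1 | h1 <;> rcases key b hb with h2 | h2 <;>
        rcases key c hc with h3 | h3 <;>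
        first
        | exact hab (hd _ _ _ h1 h2)
        | exact hac (hd _ _ _ h1 h3)
        | exact hbc (hd _ _ _ h2 h3)
    have h4 := inner_le_nonneg_pow S d hc
    change (∑ k ∈ Finset.range N, d k) ^ 4 ≤ 8 * ∑ k ∈ Finset.range N, d k ^ 4
    rw [e1]
    linarith
  obtain ⟨C, hC0, hC⟩ : ∃ C : ℝ, 0 ≤ C ∧ C ^ 4 = 8 * N * M ^ 4 := by
    refine ⟨(8 * N * M ^ 4) ^ ((1:ℝ)/4), by positivity, ?_⟩
    rw [← Real.rpow_natCast, ← Real.rpow_mul (by positivity)]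
    norm_num
  rw [← hC]
  refine pow_le_pow_left₀ (norm_nonneg _) ?_ 4
  rw [J.norm_iff _ _ hC0, hC]
  intro F hF
  calc VV F (fun n => J.c n (∑ k ∈ Finset.range N, z k))
      = ∑ p ∈ F, (∑ k ∈ Finset.range N, (J.c p.2 (z k) - J.c p.1 (z k))) ^ 4 := by
        simp [VV, map_sum, Finset.sum_sub_distrib]
    _ ≤ ∑ p ∈ F, 8 * ∑ k ∈ Finset.range N, (J.c p.2 (z k) - J.c p.1 (z k)) ^ 4 :=
        Finset.sum_le_sum fun p _ => hpt _ _
    _ = 8 * ∑ k ∈ Finset.range N, VV F (fun n => J.c n (z k)) := by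
        rw [← Finset.mul_sum, Finset.sum_comm]; rfl
    _ ≤ 8 * ∑ k ∈ Finset.range N, M ^ 4 := by
        gcongr with k _
        exact (J.VV_le _ F hF).trans (pow_le_pow_left₀ (norm_nonneg _) (hz k) 4)
    _ = 8 * N * M ^ 4 := by simp; ring

end JS

theorem tail_small {y : ℕ → ℝ} {K : ℝ} (hK : ∀ F, IsPart F → VV F y ≤ K) (δ : ℝ) (hδ : 0 < δ) :
    ∃ n, ∀ F, IsPart F → (∀ p ∈ F, n ≤ p.1) → VV F y < δ := by
  by_contra! h
  have ind : ∀ N : ℕ, ∃ F, IsPart F ∧ N * δ ≤ VV F y := by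
    intro N
    induction N with
    | zero => exact ⟨∅, ⟨by simp, by simp⟩, by simp [VV]⟩
    | succ N ih =>
      obtain ⟨F, hF, hV⟩ := ih
      obtain ⟨G, hG, hGm, hGV⟩ := h (∑ p ∈ F, p.2)
      have hb : ∀ p ∈ F, p.2 ≤ ∑ p ∈ F, p.2 := fun p hp =>
        Finset.single_le_sum (f := fun p : ℕ × ℕ => p.2) (fun _ _ => Nat.zero_le _) hp
      have hdis : Disjoint F G := by
        rw [Finset.disjoint_left]
        intro p hp hq
        have := hF.1 p hp
        have := hb p hp
        have := hGm p hq
        omega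
      refine ⟨F ∪ G, ⟨?_, ?_⟩, ?_⟩
      · intro p hp
        rcases Finset.mem_union.1 hp with h | h
        · exact hF.1 p h
        · exact hG.1 p h
      · intro p hp q hq n h1 h2 h3 h4
        rcases Finset.mem_union.1 hp with h | h <;> rcases Finset.mem_union.1 hq with h' | h'
        · exact hF.2 p h q h' n h1 h2 h3 h4
        · have := hb p h
          have := hGm q h'
          omega
        · have := hb q h'
          have := hGm p h
          omega
        · exact hG.2 p h q h' n h1 h2 h3 h4
      · have : VV (F ∪ G) y = VV F y + VV G y := Finset.sum_union hdis
        rw [this]; push_cast; linarith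
  obtain ⟨N, hN⟩ := exists_nat_gt (K / δ)
  obtain ⟨F, hF, hV⟩ := ind N
  have := hK F hF
  rw [div_lt_iff₀ hδ] at hN
  linarith

theorem part_pair (a b : ℕ) (h : a < b) : IsPart {(a, b)} := by
  constructor
  · intro p hp; simp at hp; subst hp; exact h
  · intro p hp q hq; simp at hp hq; subst hp; subst hq; intros; rfl

theorem lim_of_VV {y : ℕ → ℝ} {K : ℝ} (hK : ∀ F, IsPart F → VV F y ≤ K) :
    ∃ c, Tendsto y atTop (𝓝 c) := by
  apply cauchySeq_tendsto_of_complete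
  rw [Metric.cauchySeq_iff']
  intro ε hε
  obtain ⟨n, hn⟩ := tail_small hK (ε ^ 4) (by positivity)
  refine ⟨n, fun m hm => ?_⟩
  rcases hm.eq_or_lt with h | h
  · subst h; simpa using hε
  · have := hn _ (part_pair n m h) (by simp)
    rw [Real.dist_eq]
    refine lt_of_pow_lt_pow_left₀ 4 hε.le ?_
    rw [(by decide : Even 4).pow_abs]
    simpa [VV] using this

namespace JS

variable {X : Type} [NormedAddCommGroup X] [NormedSpace ℝ X] (J : JS X)

theorem no_hump (f : X →L[ℝ] ℝ) (ε M : ℝ) (hε : 0 < ε) (hM : 0 ≤ M) (z : ℕ → X)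
    (hz : ∀ k, ‖z k‖ ≤ M) (hd : ∀ k l n, J.c n (z k) ≠ 0 → J.c n (z l) ≠ 0 → k = l)
    (hf : ∀ k, f (z k) = ε) : False := by
  obtain ⟨N, hN⟩ := exists_nat_gt (8 * ‖f‖ ^ 4 * M ^ 4 / ε ^ 4)
  rw [div_lt_iff₀ (by positivity)] at hN
  have hN0 : (0:ℝ) < N := by
    by_contra! h
    have : 0 ≤ 8 * ‖f‖ ^ 4 * M ^ 4 := by positivity
    have : (N:ℝ) * ε ^ 4 ≤ 0 := mul_nonpos_of_nonpos_of_nonneg h (by positivity)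
    linarith
  have hN1 : (1:ℝ) ≤ N := by exact_mod_cast (Nat.cast_pos.1 hN0 : 0 < N)
  have h1 := J.upper N z M hM hz hd
  have h2 : f (∑ k ∈ Finset.range N, z k) = N * ε := by simp [hf]
  have h3 : N * ε ≤ ‖f‖ * ‖∑ k ∈ Finset.range N, z k‖ := by
    rw [← h2]; exact (le_abs_self _).trans (f.le_opNorm _)
  have h4 := pow_le_pow_left₀ (by positivity) h3 4
  rw [mul_pow, mul_pow] at h4
  have h5 : ‖f‖ ^ 4 * ‖∑ k ∈ Finset.range N, z k‖ ^ 4 ≤ ‖f‖ ^ 4 * (8 * N * M ^ 4) := by gcongr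
  have h6 : (N:ℝ) * (N ^ 3 * ε ^ 4) ≤ N * (8 * ‖f‖ ^ 4 * M ^ 4) := by nlinarith
  have h7 := le_of_mul_le_mul_left h6 hN0
  have h8 : (N:ℝ) * ε ^ 4 ≤ N ^ 3 * ε ^ 4 := by
    gcongr
    exact le_self_pow₀ hN1 (by norm_num)
  linarith

/-- tail operator -/
def R (n : ℕ) : X →L[ℝ] X := ContinuousLinearMap.id ℝ X - J.P 0 n

theorem R_apply (n : ℕ) (x : X) : J.R n x = x - J.P 0 n x := rfl

theorem shrinking (f : X →L[ℝ] ℝ) : Tendsto (fun n => ‖f.comp (J.R n)‖) atTop (𝓝 0) := by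
  rw [Metric.tendsto_atTop]
  by_contra! h
  obtain ⟨ε', hε', h⟩ := h
  obtain ⟨ε, hε, hlt⟩ := exists_between hε'
  have step : ∀ n : ℕ, ∃ (m : ℕ) (z : X), n ≤ m ∧ ‖z‖ ≤ 2 ∧ f z = ε ∧
      ∀ k, J.c k z ≠ 0 → n < k ∧ k ≤ m := by
    intro n0
    obtain ⟨n, hn, h1⟩ := h n0
    rw [dist_zero_right, norm_norm] at h1
    obtain ⟨x, hx⟩ : ∃ x, ε * ‖x‖ < ‖f.comp (J.R n) x‖ := by
      by_contra! h2
      have := ContinuousLinearMap.opNorm_le_bound _ hε.le h2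
      linarith
    have ht : Tendsto (fun m => ‖f (J.P 0 m x - J.P 0 n x)‖) atTop (𝓝 ‖f (x - J.P 0 n x)‖) :=
      ((f.continuous.tendsto _).comp ((J.tendsto_P x).sub_const _)).norm
    obtain ⟨m, hm, hmn⟩ := ((ht.eventually (lt_mem_nhds hx)).and (eventually_ge_atTop n)).exists
    have hP : J.P 0 m x - J.P 0 n x = J.P n m x := by
      simp only [P_apply, blk]
      rw [sub_eq_iff_eq_add, add_comm, Finset.sum_Ico_consecutive _ (Nat.zero_le _) hmn]
    rw [hP] at hm
    have hx0 : 0 < ‖x‖ := by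
      rw [norm_pos_iff]; rintro rfl
      simp at hm
    have hw : 0 < ‖f (J.P n m x)‖ := lt_of_le_of_lt (by positivity) hm
    have hw0 : f (J.P n m x) ≠ 0 := norm_pos_iff.1 hw
    refine ⟨m, (ε / f (J.P n m x)) • J.P n m x, hn.trans hmn, ?_, ?_, ?_⟩
    · rw [norm_smul, norm_div, Real.norm_of_nonneg hε.le, div_mul_eq_mul_div, div_le_iff₀ hw]
      have := J.P_norm n m x
      nlinarith
    · simp [hw0]
    · intro k hk
      rw [map_smul, smul_eq_mul, P_apply, c_blk, trunc] at hk
      split_ifs at hk with h9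
      · exact ⟨lt_of_le_of_lt hn h9.1, h9.2⟩
      · simp at hk
  choose mm zz h1 h2 h3 h4 using step
  let a : ℕ → ℕ := fun k => Nat.rec 0 (fun _ r => mm r) k
  have ha : ∀ k, a (k + 1) = mm (a k) := fun k => rfl
  have hmono : Monotone a := monotone_nat_of_le_succ fun k => by rw [ha]; exact h1 _
  refine J.no_hump f ε 2 hε (by norm_num) (fun k => zz (a k)) (fun k => h2 _) ?_ (fun k => h3 _)
  intro k l n hk hl
  have hk' := h4 _ _ hk
  have hl' := h4 _ _ hl
  rw [← ha] at hk' hl'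
  by_contra hne
  rcases Nat.lt_or_gt_of_ne hne with h | h
  · have := hmono (show k + 1 ≤ l from h)
    omega
  · have := hmono (show l + 1 ≤ k from h)
    omega

theorem v_norm (n : ℕ) : ‖J.v n‖ ≤ 2 := J.blk_one_norm 0 n

theorem v_lim (f : X →L[ℝ] ℝ) : ∃ L, Tendsto (fun n => f (J.v n)) atTop (𝓝 L) := by
  apply cauchySeq_tendsto_of_complete
  rw [Metric.cauchySeq_iff']
  intro ε hε
  obtain ⟨n, hn⟩ := ((J.shrinking f).eventually (gt_mem_nhds (show 0 < ε / 2 by positivity))).exists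
  refine ⟨n, fun m hm => ?_⟩
  rw [Real.dist_eq, ← map_sub, J.v_sub n m hm]
  have hR : J.R n (J.blk (fun _ => 1) n m) = J.blk (fun _ => 1) n m := by
    rw [R_apply, sub_eq_self]
    refine J.ext_c fun k => ?_
    rw [P_apply, c_blk, map_zero]
    simp only [trunc, c_blk]
    split_ifs <;> first | rfl | omega
  have h1 : f (J.blk (fun _ => 1) n m) = f.comp (J.R n) (J.blk (fun _ => 1) n m) := by
    rw [ContinuousLinearMap.comp_apply, hR]
  rw [h1]
  have h2 := (f.comp (J.R n)).le_opNorm (J.blk (fun _ => 1) n m)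
  have h3 := J.blk_one_norm n m
  rw [Real.norm_eq_abs] at h2
  have h4 : ‖f.comp (J.R n)‖ * ‖J.blk (fun _ => 1) n m‖ ≤ ‖f.comp (J.R n)‖ * 2 := by gcongr
  linarith

def thetaFun (f : X →L[ℝ] ℝ) : ℝ := (J.v_lim f).choose

theorem thetaFun_spec (f : X →L[ℝ] ℝ) : Tendsto (fun n => f (J.v n)) atTop (𝓝 (J.thetaFun f)) :=
  (J.v_lim f).choose_spec

def theta : (X →L[ℝ] ℝ) →L[ℝ] ℝ :=
  LinearMap.mkContinuous
    { toFun := J.thetaFun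
      map_add' := fun f g => tendsto_nhds_unique (J.thetaFun_spec (f + g))
        ((J.thetaFun_spec f).add (J.thetaFun_spec g))
      map_smul' := fun a f => tendsto_nhds_unique (J.thetaFun_spec (a • f))
        ((J.thetaFun_spec f).const_mul a) } 2 (fun f => by
      refine le_of_tendsto (J.thetaFun_spec f).norm (Eventually.of_forall fun n => ?_)
      have := f.le_opNorm (J.v n)
      have h3 := J.v_norm n
      have : ‖f‖ * ‖J.v n‖ ≤ ‖f‖ * 2 := by gcongr
      linarith)

theorem theta_spec (f : X →L[ℝ] ℝ) : Tendsto (fun n => f (J.v n)) atTop (𝓝 (J.theta f)) :=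
  J.thetaFun_spec f

theorem theta_c (n : ℕ) : J.theta (J.c (n + 1)) = 1 := by
  refine tendsto_nhds_unique (J.theta_spec _) (tendsto_const_nhds.congr' ?_)
  filter_upwards [eventually_ge_atTop (n + 1)] with m hm
  rw [v, c_blk, trunc, if_pos (by omega)]

theorem bidual_VV (φ : (X →L[ℝ] ℝ) →L[ℝ] ℝ) (F) (hF : IsPart F) :
    VV F (fun n => φ (J.c n)) ≤ 16 * (‖φ‖ + 1) ^ 4 := by
  set K := ‖φ‖ + 1 with hK
  have hK0 : 0 < K := by positivity
  set d : ℕ × ℕ → ℝ := fun p => φ (J.c p.2) - φ (J.c p.1) with hd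
  set g : X →L[ℝ] ℝ := ∑ p ∈ F, d p ^ 3 • (J.c p.2 - J.c p.1) with hg
  set A := VV F (fun n => φ (J.c n)) with hA
  have hA0 : 0 ≤ A := VV_nonneg _ _
  have hAg : A = φ g := by
    simp only [hA, hg, VV, map_sum, map_smul, map_sub, smul_eq_mul]
    refine Finset.sum_congr rfl fun p _ => ?_
    simp only [hd]; ring
  have young : ∀ a b : ℝ, |a ^ 3 * b| ≤ a ^ 4 / 2 + 8 * b ^ 4 := by
    intro a b
    rw [abs_mul, abs_pow, ← (by decide : Even 4).pow_abs a, ← (by decide : Even 4).pow_abs b]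
    have ha := abs_nonneg a
    have hb := abs_nonneg b
    generalize |a| = s at *
    generalize |b| = t at *
    rcases le_total t (s / 2) with h | h
    · have : s ^ 3 * t ≤ s ^ 3 * (s / 2) := by gcongr
      have : 0 ≤ t ^ 4 := by positivity
      nlinarith
    · have : s ^ 3 * t ≤ (2 * t) ^ 3 * t := by gcongr; linarith
      have : 0 ≤ s ^ 4 := by positivity
      nlinarith
  have hb : ‖g‖ ≤ (A / 2 + 8 * K ^ 4) / K := by
    refine ContinuousLinearMap.opNorm_le_of_unit_norm (by positivity) fun x hx => ?_
    rw [le_div_iff₀ hK0]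
    have e1 : g x * K = ∑ p ∈ F, d p ^ 3 * (K * (J.c p.2 x - J.c p.1 x)) := by
      rw [hg, _root_.sum_apply, Finset.sum_mul]
      refine Finset.sum_congr rfl fun p _ => ?_
      simp; ring
    have e2 : ‖g x‖ * K = |g x * K| := by rw [abs_mul, abs_of_pos hK0]; rfl
    rw [e2, e1]
    calc _ ≤ ∑ p ∈ F, |d p ^ 3 * (K * (J.c p.2 x - J.c p.1 x))| := Finset.abs_sum_le_sum_abs _ _
      _ ≤ ∑ p ∈ F, (d p ^ 4 / 2 + 8 * (K * (J.c p.2 x - J.c p.1 x)) ^ 4) :=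
        Finset.sum_le_sum fun p _ => young _ _
      _ = A / 2 + 8 * K ^ 4 * VV F (fun n => J.c n x) := by
        rw [Finset.sum_add_distrib, hA, VV, VV, Finset.sum_div, Finset.mul_sum]
        congr 1
        refine Finset.sum_congr rfl fun p _ => ?_
        ring
      _ ≤ A / 2 + 8 * K ^ 4 := by
        have := J.VV_le x F hF
        rw [hx, one_pow] at this
        have : 8 * K ^ 4 * VV F (fun n => J.c n x) ≤ 8 * K ^ 4 * 1 := by gcongr
        linarith
  have h1 : A ≤ K * ((A / 2 + 8 * K ^ 4) / K) := by
    calc A = φ g := hAg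
      _ ≤ ‖φ‖ * ‖g‖ := (le_abs_self _).trans (φ.le_opNorm g)
      _ ≤ K * ((A / 2 + 8 * K ^ 4) / K) := by gcongr; linarith
  rw [mul_div_cancel₀ _ hK0.ne'] at h1
  linarith

theorem elem [CompleteSpace X] {y : ℕ → ℝ} {K : ℝ} (hK : ∀ F, IsPart F → VV F y ≤ K)
    (hy : Tendsto y atTop (𝓝 0)) : ∃ x : X, ∀ n, J.c (n + 1) x = y (n + 1) := by
  have hC : CauchySeq (fun m => J.blk y 0 m) := by
    rw [Metric.cauchySeq_iff']
    intro ε hε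
    obtain ⟨n, hn⟩ := tail_small hK ((ε / 2) ^ 4 / 2) (by positivity)
    have hy4 : Tendsto (fun k => y k ^ 4) atTop (𝓝 0) := by simpa using hy.pow 4
    obtain ⟨k, hk⟩ := eventually_atTop.1
      (hy4.eventually (gt_mem_nhds (show 0 < (ε / 2) ^ 4 / 4 by positivity)))
    refine ⟨max n k, fun m hm => ?_⟩
    have hP : J.blk y 0 m - J.blk y 0 (max n k) = J.blk y (max n k) m := by
      simp only [blk]
      rw [sub_eq_iff_eq_add, add_comm, Finset.sum_Ico_consecutive _ (Nat.zero_le _) hm]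
    rw [dist_eq_norm, hP]
    refine lt_of_le_of_lt (J.blk_norm y (max n k) m ((ε / 2) ^ 4 / 4) (ε / 2) (by positivity)
      (by positivity) ?_ ?_) (by linarith)
    · intro j hj
      exact (hk j ((le_max_right n k).trans hj.le)).le
    · intro F hF hFm
      have := hn F hF (fun p hp => (le_max_left n k).trans (hFm p hp).le)
      linarith
  obtain ⟨x, hx⟩ := cauchySeq_tendsto_of_complete hC
  refine ⟨x, fun n => ?_⟩
  refine tendsto_nhds_unique (((J.c (n + 1)).continuous.tendsto x).comp hx)
    (tendsto_const_nhds.congr' ?_)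
  filter_upwards [eventually_ge_atTop (n + 1)] with m hm
  simp only [Function.comp]
  rw [c_blk, trunc, if_pos (by omega)]

theorem bidual [CompleteSpace X] (φ : (X →L[ℝ] ℝ) →L[ℝ] ℝ) :
    ∃ (x : X) (a : ℝ), ∀ f, φ f = f x + a * J.theta f := by
  have hV := J.bidual_VV φ
  obtain ⟨a, ha⟩ := lim_of_VV hV
  have hV' : ∀ F, IsPart F → VV F (fun n => φ (J.c n) - a) ≤ 16 * (‖φ‖ + 1) ^ 4 := by
    intro F hF
    have := hV F hF
    simpa [VV] using this
  obtain ⟨x, hx⟩ := J.elem hV' (by simpa using ha.sub_const a)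
  refine ⟨x, a, fun f => ?_⟩
  set ψ : (X →L[ℝ] ℝ) →L[ℝ] ℝ :=
    φ - NormedSpace.inclusionInDoubleDual ℝ X x - a • J.theta with hψ
  have hψ_apply : ∀ f, ψ f = φ f - f x - a * J.theta f := fun f => rfl
  have hc : ∀ n, ψ (J.c (n + 1)) = 0 := by
    intro n
    rw [hψ_apply, hx, theta_c]; ring
  have hdec : ∀ n, ψ f = ψ (f.comp (J.R n)) := by
    intro n
    have h1 : f = f.comp (J.R n) + ∑ i ∈ Finset.Ico 0 n, f (J.e i) • J.c (i + 1) := by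
      ext z
      simp [R_apply, P_apply, blk, mul_comm]
    conv_lhs => rw [h1]
    simp [map_add, map_sum, hc]
  have hz : ψ f = 0 := by
    rw [← norm_le_zero_iff]
    have ht : Tendsto (fun n => ‖ψ‖ * ‖f.comp (J.R n)‖) atTop (𝓝 0) := by
      simpa using (J.shrinking f).const_mul ‖ψ‖
    refine ge_of_tendsto ht (Eventually.of_forall fun n => ?_)
    rw [hdec n]
    exact ψ.le_opNorm _
  rw [hψ_apply] at hz
  linarith

end JS

namespace JS

variable {X : Type} [NormedAddCommGroup X] [NormedSpace ℝ X] (J : JS X)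

theorem blk_disj {w : ℕ → ℕ} (hw : Monotone w) (s : ℕ) (k l n : ℕ)
    (hk : J.c n (J.blk (fun _ => 1) (w (4 * k + s)) (w (4 * k + s + 2))) ≠ 0)
    (hl : J.c n (J.blk (fun _ => 1) (w (4 * l + s)) (w (4 * l + s + 2))) ≠ 0) : k = l := by
  rw [c_blk, trunc] at hk hl
  have h1 : w (4 * k + s) < n ∧ n ≤ w (4 * k + s + 2) := by
    by_contra h
    rw [if_neg h] at hk
    exact hk rfl
  have h2 : w (4 * l + s) < n ∧ n ≤ w (4 * l + s + 2) := by
    by_contra h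
    rw [if_neg h] at hl
    exact hl rfl
  by_contra hne
  rcases Nat.lt_or_gt_of_ne hne with h | h
  · have := hw (show 4 * k + s + 2 ≤ 4 * l + s by omega)
    omega
  · have := hw (show 4 * l + s + 2 ≤ 4 * k + s by omega)
    omega

theorem double_lim (T : X →L[ℝ] (X →L[ℝ] ℝ)) (α β : ℝ) (r s : ℕ → ℝ)
    (hr : ∀ i, Tendsto (fun j => T (J.v i) (J.v j)) atTop (𝓝 (r i)))
    (hα : Tendsto r atTop (𝓝 α))
    (hs : ∀ j, Tendsto (fun i => T (J.v i) (J.v j)) atTop (𝓝 (s j)))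
    (hβ : Tendsto s atTop (𝓝 β)) : α = β := by
  by_contra hne
  set δ := |α - β| with hδ
  have hδ0 : 0 < δ := abs_pos.2 (sub_ne_zero.2 hne)
  obtain ⟨N, hN⟩ := exists_nat_gt (16 * 16384 * ‖T‖ ^ 4 / δ ^ 4)
  rw [div_lt_iff₀ (by positivity)] at hN
  have hN0 : (0:ℝ) < N := by
    by_contra! h
    have : 0 ≤ 16 * 16384 * ‖T‖ ^ 4 := by positivity
    have : (N:ℝ) * δ ^ 4 ≤ 0 := mul_nonpos_of_nonpos_of_nonneg h (by positivity)
    linarith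
  have hN1 : (1:ℝ) ≤ N := by exact_mod_cast (Nat.cast_pos.1 hN0 : 0 < N)
  set ε := δ / (8 * N) with hε
  have hε0 : 0 < ε := by positivity
  obtain ⟨n0, hn0⟩ : ∃ n0, ∀ n ≥ n0, ∃ g, ∀ m ≥ g,
      |T (J.v n) (J.v m) - α| < ε ∧ |T (J.v m) (J.v n) - β| < ε := by
    obtain ⟨n0, h0⟩ := eventually_atTop.1
      ((hα.eventually (Metric.ball_mem_nhds α hε0)).and (hβ.eventually (Metric.ball_mem_nhds β hε0)))
    refine ⟨n0, fun n hn => ?_⟩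
    obtain ⟨h1, h2⟩ := h0 n hn
    obtain ⟨g, hg⟩ := eventually_atTop.1
      (((hr n).eventually (Metric.isOpen_ball.mem_nhds h1)).and
        ((hs n).eventually (Metric.isOpen_ball.mem_nhds h2)))
    refine ⟨g, fun m hm => ?_⟩
    have := hg m hm
    simpa only [Metric.mem_ball, Real.dist_eq] using this
  have hG : ∀ n, ∃ g, n0 ≤ n → ∀ m ≥ g,
      |T (J.v n) (J.v m) - α| < ε ∧ |T (J.v m) (J.v n) - β| < ε := by
    intro n
    by_cases h : n0 ≤ n
    · obtain ⟨g, hg⟩ := hn0 n h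
      exact ⟨g, fun _ => hg⟩
    · exact ⟨0, fun h' => absurd h' h⟩
  choose g hg using hG
  let w : ℕ → ℕ := fun k => Nat.rec n0 (fun _ r => r + g r) k
  have hw1 : ∀ k, w (k + 1) = w k + g (w k) := fun k => rfl
  have hmono : Monotone w := monotone_nat_of_le_succ fun k => by rw [hw1]; omega
  have hwn : ∀ k, n0 ≤ w k := fun k => hmono (Nat.zero_le k)
  have hlt : ∀ k l, k < l → |T (J.v (w k)) (J.v (w l)) - α| < ε ∧
      |T (J.v (w l)) (J.v (w k)) - β| < ε := by
    intro k l hkl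
    refine hg (w k) (hwn k) (w l) ?_
    have := hmono (show k + 1 ≤ l from hkl)
    rw [hw1] at this
    omega
  let x : ℕ → X := fun k => J.blk (fun _ => 1) (w (4 * k + 0)) (w (4 * k + 0 + 2))
  let y : ℕ → X := fun k => J.blk (fun _ => 1) (w (4 * k + 1)) (w (4 * k + 1 + 2))
  have hx : ∀ k, x k = J.v (w (4 * k + 2)) - J.v (w (4 * k)) := fun k =>
    (J.v_sub _ _ (hmono (Nat.le_add_right _ 2))).symm
  have hy : ∀ k, y k = J.v (w (4 * k + 3)) - J.v (w (4 * k + 1)) := fun k =>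
    (J.v_sub (w (4 * k + 1)) (w (4 * k + 1 + 2)) (hmono (Nat.le_add_right (4 * k + 1) 2))).symm
  have hxU := J.upper N x 2 (by norm_num) (fun k => J.blk_one_norm _ _) (J.blk_disj hmono 0)
  have hyU := J.upper N y 2 (by norm_num) (fun k => J.blk_one_norm _ _) (J.blk_disj hmono 1)
  have hent : ∀ k l, |T (x k) (y l) - (if k = l then α - β else 0)| ≤ 4 * ε := by
    intro k l
    rw [hx, hy]
    simp only [map_sub, sub_apply]
    rcases lt_trichotomy k l with h | h | h
    · rw [if_neg h.ne]
      have h1 := (hlt (4 * k + 2) (4 * l + 3) (by omega)).1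
      have h2 := (hlt (4 * k + 2) (4 * l + 1) (by omega)).1
      have h3 := (hlt (4 * k) (4 * l + 3) (by omega)).1
      have h4 := (hlt (4 * k) (4 * l + 1) (by omega)).1
      rw [abs_lt] at h1 h2 h3 h4
      rw [abs_le]; constructor <;> linarith
    · subst h
      rw [if_pos rfl]
      have h1 := (hlt (4 * k + 2) (4 * k + 3) (by omega)).1
      have h2 := (hlt (4 * k + 1) (4 * k + 2) (by omega)).2
      have h3 := (hlt (4 * k) (4 * k + 3) (by omega)).1
      have h4 := (hlt (4 * k) (4 * k + 1) (by omega)).1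
      rw [abs_lt] at h1 h2 h3 h4
      rw [abs_le]; constructor <;> linarith
    · rw [if_neg h.ne']
      have h1 := (hlt (4 * l + 3) (4 * k + 2) (by omega)).2
      have h2 := (hlt (4 * l + 1) (4 * k + 2) (by omega)).2
      have h3 := (hlt (4 * l + 3) (4 * k) (by omega)).2
      have h4 := (hlt (4 * l + 1) (4 * k) (by omega)).2
      rw [abs_lt] at h1 h2 h3 h4
      rw [abs_le]; constructor <;> linarith
  set sx := ∑ k ∈ Finset.range N, x k with hsx
  set sy := ∑ k ∈ Finset.range N, y k with hsy
  have hsum : |T sx sy - N * (α - β)| ≤ N * (N * (4 * ε)) := by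
    have e1 : T sx sy - N * (α - β) = ∑ k ∈ Finset.range N, ∑ l ∈ Finset.range N,
        (T (x k) (y l) - (if k = l then α - β else 0)) := by
      simp only [Finset.sum_sub_distrib]
      congr 1
      · rw [hsx, hsy]
        simp only [map_sum, _root_.sum_apply]
        rw [Finset.sum_comm]
      · have : ∀ k ∈ Finset.range N, ∑ l ∈ Finset.range N, (if k = l then α - β else 0) = α - β := by
          intro k hk
          rw [Finset.sum_ite_eq, if_pos hk]
        rw [Finset.sum_congr rfl this, Finset.sum_const, Finset.card_range, nsmul_eq_mul]
    rw [e1]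
    calc _ ≤ ∑ k ∈ Finset.range N, |∑ l ∈ Finset.range N,
        (T (x k) (y l) - (if k = l then α - β else 0))| := Finset.abs_sum_le_sum_abs _ _
      _ ≤ ∑ k ∈ Finset.range N, ∑ l ∈ Finset.range N,
        |T (x k) (y l) - (if k = l then α - β else 0)| :=
          Finset.sum_le_sum fun _ _ => Finset.abs_sum_le_sum_abs _ _
      _ ≤ ∑ k ∈ Finset.range N, ∑ l ∈ Finset.range N, 4 * ε :=
          Finset.sum_le_sum fun _ _ => Finset.sum_le_sum fun _ _ => hent _ _
      _ = _ := by simp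
  have he : N * (N * (4 * ε)) = N * δ / 2 := by rw [hε]; field_simp; ring
  have hlow : N * δ / 2 ≤ |T sx sy| := by
    have h1 : |N * (α - β)| = N * δ := by rw [abs_mul, abs_of_pos hN0]
    have h2 := abs_sub_abs_le_abs_sub (N * (α - β)) (T sx sy)
    rw [abs_sub_comm] at hsum
    linarith
  have hup : |T sx sy| ≤ ‖T‖ * ‖sx‖ * ‖sy‖ := T.le_opNorm₂ sx sy
  have h4 := pow_le_pow_left₀ (by positivity) (hlow.trans hup) 4
  rw [mul_pow, mul_pow] at h4
  have h5 : ‖T‖ ^ 4 * ‖sx‖ ^ 4 * ‖sy‖ ^ 4 ≤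
      ‖T‖ ^ 4 * (8 * N * 2 ^ 4) * (8 * N * 2 ^ 4) := by gcongr
  have h6 : (N:ℝ) ^ 2 * (N ^ 2 * δ ^ 4) ≤ N ^ 2 * (16 * 16384 * ‖T‖ ^ 4) := by nlinarith
  have h7 := le_of_mul_le_mul_left h6 (by positivity)
  have h8 : (N:ℝ) * δ ^ 4 ≤ N ^ 2 * δ ^ 4 := by
    gcongr
    exact le_self_pow₀ hN1 (by norm_num)
  linarith

theorem arens (J : JS X) [CompleteSpace X] (T : X →L[ℝ] (X →L[ℝ] ℝ)) (φ ψ : (X →L[ℝ] ℝ) →L[ℝ] ℝ) :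
    ψ (φ.comp T.flip) = φ (ψ.comp T) := by
  obtain ⟨x, a, hφ⟩ := J.bidual φ
  obtain ⟨y, b, hψ⟩ := J.bidual ψ
  have hθ : J.theta (J.theta.comp T.flip) = J.theta (J.theta.comp T) := by
    symm
    exact J.double_lim T _ _ (fun i => J.theta (T (J.v i))) (fun j => J.theta (T.flip (J.v j)))
      (fun i => J.theta_spec _) (J.theta_spec (J.theta.comp T)) (fun j => J.theta_spec (T.flip (J.v j)))
      (J.theta_spec (J.theta.comp T.flip))
  have e1 : φ.comp T.flip = T x + a • J.theta.comp T.flip := by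
    ext z; simp [hφ]
  have e2 : ψ.comp T = T.flip y + b • J.theta.comp T := by
    ext z; simp [hψ]
  rw [e1, e2, map_add, map_add, map_smul, map_smul, hψ, hψ, hφ, hφ, hθ]
  simp
  ring

theorem propW (J : JS X) [CompleteSpace X] : PropertyW X := by
  intro T
  unfold IsWeaklyCompactOperator
  let G : WeakDual ℝ (X →L[ℝ] ℝ) → WeakSpace ℝ (X →L[ℝ] ℝ) := fun φ =>
    toWeakSpace ℝ (X →L[ℝ] ℝ) ((WeakDual.toStrongDual φ).comp T.flip)
  have hG : Continuous G := by
    refine WeakBilin.continuous_of_continuous_eval _ fun ψ => ?_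
    have : ∀ φ : WeakDual ℝ (X →L[ℝ] ℝ), ψ ((WeakDual.toStrongDual φ).comp T.flip) = φ (ψ.comp T) :=
      fun φ => J.arens T (WeakDual.toStrongDual φ) ψ
    have h2 : Continuous fun φ : WeakDual ℝ (X →L[ℝ] ℝ) => φ (ψ.comp T) :=
      WeakDual.eval_continuous _
    exact h2.congr fun φ => (this φ).symm
  have hT2 : T2Space (WeakSpace ℝ (X →L[ℝ] ℝ)) := inferInstance
  have hK := (WeakDual.isCompact_closedBall (𝕜 := ℝ) (E := X →L[ℝ] ℝ) 0 1).image hG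
  refine hK.of_isClosed_subset isClosed_closure (closure_minimal ?_ hK.isClosed)
  rintro _ ⟨_, ⟨x, hx, rfl⟩, rfl⟩
  refine ⟨StrongDual.toWeakDual (NormedSpace.inclusionInDoubleDual ℝ X x), ?_, ?_⟩
  · change NormedSpace.inclusionInDoubleDual ℝ X x ∈ Metric.closedBall 0 1
    rw [mem_closedBall_zero_iff] at hx
    have h1 : ‖NormedSpace.inclusionInDoubleDual ℝ X x‖ ≤ 1 :=
      (NormedSpace.double_dual_bound ℝ X x).trans hx
    exact (mem_closedBall_zero_iff (E := StrongDual ℝ (StrongDual ℝ X))).2 h1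
  · rfl

theorem not_wsc (J : JS X) : ¬ WeaklySeqComplete (X →L[ℝ] ℝ) := by
  intro h
  obtain ⟨f, hf⟩ := h (fun n => J.c (n + 1)) (fun φ => by
    obtain ⟨a, ha⟩ := lim_of_VV (J.bidual_VV φ)
    exact ⟨a, (tendsto_add_atTop_iff_nat 1).2 ha⟩)
  have hf0 : f = 0 := by
    ext x
    have h1 : Tendsto (fun n => J.c (n + 1) x) atTop (𝓝 (f x)) :=
      hf (NormedSpace.inclusionInDoubleDual ℝ X x)
    refine tendsto_nhds_unique h1 ?_
    rw [Metric.tendsto_atTop]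
    intro ε hε
    obtain ⟨m, hm⟩ := Metric.tendsto_atTop.1 (J.tendsto_P x) ε hε
    refine ⟨m, fun n hn => ?_⟩
    have h2 := hm m le_rfl
    rw [dist_eq_norm, norm_sub_rev] at h2
    have h3 := J.abs_c_le (n + 1) (x - J.P 0 m x)
    rw [map_sub, P_apply, c_blk, trunc, if_neg (by omega), sub_zero] at h3
    change dist _ (0 : ℝ) < ε
    rw [dist_zero_right]
    rw [P_apply] at h2
    exact lt_of_le_of_lt h3 h2
  have h1 := hf J.theta
  rw [hf0, map_zero] at h1
  simp only [theta_c] at h1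
  exact one_ne_zero (tendsto_nhds_unique tendsto_const_nhds h1)

end JS

end

/-- a Banach space with Property (w) whose dual is not weakly
sequentially complete. -/
theorem statement4 : ∃ (X : Type) (_ : NormedAddCommGroup X) (_ : NormedSpace ℝ X)
    (_ : CompleteSpace X), PropertyW X ∧ ¬ WeaklySeqComplete (X →L[ℝ] ℝ) := by
  have := XX_complete
  exact ⟨XX, inferInstance, inferInstance, XX_complete, theJS.propW, theJS.not_wsc⟩
end

section
/- There exists a non-reflexive Banach space X such that for every closed subspace Y of X, every bounded linear operator from Y into the dual X' is compact. -/
open Filter Topology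

namespace CZ

open scoped ZeroAtInfty

def X0 : Type := C₀(ℕ, ℝ)

noncomputable instance instNG : NormedAddCommGroup X0 :=
  (inferInstance : NormedAddCommGroup C₀(ℕ, ℝ))

noncomputable instance instNS : NormedSpace ℝ X0 :=
  (inferInstance : NormedSpace ℝ C₀(ℕ, ℝ))

instance instCS : CompleteSpace X0 :=
  (inferInstance : CompleteSpace C₀(ℕ, ℝ))

instance instFL : FunLike X0 ℕ ℝ :=
  (inferInstance : FunLike C₀(ℕ, ℝ) ℕ ℝ)

theorem addA (x y : X0) (n : ℕ) : (x + y) n = x n + y n := rfl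

theorem subA (x y : X0) (n : ℕ) : (x - y) n = x n - y n := rfl

theorem negA (x : X0) (n : ℕ) : (-x) n = -x n := rfl

theorem norm_le_iff {x : X0} {C : ℝ} (hC : 0 ≤ C) : ‖x‖ ≤ C ↔ ∀ n, |x n| ≤ C := by
  have h : ‖x‖ = ‖ZeroAtInftyContinuousMap.toBCF (show C₀(ℕ, ℝ) from x)‖ :=
    (ZeroAtInftyContinuousMap.norm_toBCF_eq_norm (f := (show C₀(ℕ, ℝ) from x))).symm
  rw [h, BoundedContinuousFunction.norm_le hC]
  rfl

theorem abs_le_norm (x : X0) (n : ℕ) : |x n| ≤ ‖x‖ :=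
  (norm_le_iff (norm_nonneg x)).1 le_rfl n

theorem exists_small (x : X0) {δ : ℝ} (hδ : 0 < δ) : ∃ F : Finset ℕ, ∀ n, n ∉ F → |x n| < δ := by
  have h : Tendsto (fun n => x n) (cocompact ℕ) (𝓝 0) :=
    ZeroAtInftyContinuousMap.zero_at_infty' (show C₀(ℕ, ℝ) from x)
  rw [cocompact_eq_cofinite] at h
  have h2 := (Metric.tendsto_nhds.1 h) δ hδ
  rw [Filter.eventually_cofinite] at h2
  refine ⟨h2.toFinset, fun n hn => ?_⟩
  by_contra hc
  apply hn
  simpa using hc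

noncomputable def ev (n : ℕ) : X0 →L[ℝ] ℝ :=
  LinearMap.mkContinuous
    { toFun := fun x => x n
      map_add' := fun _ _ => rfl
      map_smul' := fun _ _ => rfl } 1 (fun x => by
        simpa using abs_le_norm x n)

@[simp] theorem ev_apply (n : ℕ) (x : X0) : ev n x = x n := rfl

noncomputable def e0 (j : ℕ) : C₀(ℕ, ℝ) where
  toFun := fun n => if n = j then 1 else 0
  continuous_toFun := continuous_of_discreteTopology
  zero_at_infty' := by
    rw [cocompact_eq_cofinite]
    refine tendsto_const_nhds.congr' ?_
    have : ∀ᶠ n in cofinite, n ≠ j := by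
      simp
    filter_upwards [this] with n hn
    simp [hn]

noncomputable def e (j : ℕ) : X0 := e0 j

theorem e_apply (j n : ℕ) : e j n = if n = j then 1 else 0 := rfl

noncomputable def fs (F : Finset ℕ) (a : ℕ → ℝ) : X0 := ∑ j ∈ F, a j • e j

theorem fs_apply (F : Finset ℕ) (a : ℕ → ℝ) (n : ℕ) : fs F a n = if n ∈ F then a n else 0 := by
  rw [← ev_apply, fs, map_sum]
  simp [e_apply]

theorem apply_fs (F : Finset ℕ) (a : ℕ → ℝ) (f : X0 →L[ℝ] ℝ) : f (fs F a) = ∑ j ∈ F, a j * f (e j) := by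
  simp [fs, map_sum]

theorem lemA {M : ℝ} (hM : 0 ≤ M) (u : X0) (hu : ‖u‖ < M + 1) :
    ∃ F : Finset ℕ, ∃ η > 0, ∀ z : X0, ‖z‖ ≤ M → (∀ j ∈ F, |z j| ≤ η) → ‖u + z‖ < M + 1 := by
  obtain ⟨F, hF⟩ := exists_small u (δ := 1 / 2) (by norm_num)
  refine ⟨F, (M + 1 - ‖u‖) / 2, by linarith, fun z hz hzF => ?_⟩
  have key : ‖u + z‖ ≤ max (M + 1 / 2) ((M + 1 + ‖u‖) / 2) := by
    rw [norm_le_iff (le_max_of_le_left (by linarith))]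
    intro n
    rw [addA]
    refine (abs_add_le _ _).trans ?_
    by_cases hn : n ∈ F
    · refine le_max_of_le_right ?_
      have := hzF n hn
      have := abs_le_norm u n
      linarith
    · refine le_max_of_le_left ?_
      have := hF n hn
      have := abs_le_norm z n
      linarith
  exact key.trans_lt (max_lt (by linarith) (by linarith))

theorem exists_near (g : X0 →L[ℝ] ℝ) {δ : ℝ} (hδ : 0 < δ) : ∃ x : X0, ‖x‖ ≤ 1 ∧ ‖g‖ - δ < g x := by
  obtain ⟨x, hx, hgx⟩ := ContinuousLinearMap.exists_lt_apply_of_lt_opNorm g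
    (show ‖g‖ - δ < ‖g‖ by linarith)
  rw [Real.norm_eq_abs] at hgx
  rcases lt_abs.1 hgx with h | h
  · exact ⟨x, hx.le, h⟩
  · exact ⟨-x, by rw [norm_neg]; exact hx.le, by rw [map_neg]; exact h⟩

theorem apply_le (g : X0 →L[ℝ] ℝ) (x : X0) (hx : ‖x‖ ≤ 1) : g x ≤ ‖g‖ := by
  have h1 := g.le_opNorm x
  have h2 := le_abs_self (g x)
  rw [Real.norm_eq_abs] at h1
  nlinarith [norm_nonneg g]

theorem exists_near_fs (g : X0 →L[ℝ] ℝ) {δ : ℝ} (hδ : 0 < δ) :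
    ∃ (F : Finset ℕ) (a : ℕ → ℝ), (∀ n, |a n| ≤ 1) ∧ ‖g‖ - δ < g (fs F a) := by
  obtain ⟨x, hx, hgx⟩ := exists_near g (half_pos hδ)
  have hg := norm_nonneg g
  have hd : 0 < δ / 2 / (‖g‖ + 1) := by positivity
  obtain ⟨F, hF⟩ := exists_small x hd
  refine ⟨F, x, fun n => (abs_le_norm x n).trans hx, ?_⟩
  have h1 : ‖x - fs F x‖ ≤ δ / 2 / (‖g‖ + 1) := by
    rw [norm_le_iff hd.le]
    intro n
    rw [subA, fs_apply]
    split_ifs with hn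
    · simpa using hd.le
    · simpa using (hF n hn).le
  have h2 : g (x - fs F x) ≤ δ / 2 := by
    have h3 := g.le_opNorm (x - fs F x)
    have h4 := le_abs_self (g (x - fs F x))
    rw [Real.norm_eq_abs] at h3
    have h5 : ‖g‖ * ‖x - fs F x‖ ≤ (‖g‖ + 1) * (δ / 2 / (‖g‖ + 1)) :=
      mul_le_mul (by linarith) h1 (norm_nonneg _) (by linarith)
    rw [mul_div_cancel₀ _ (by positivity)] at h5
    linarith
  rw [map_sub] at h2
  linarith

theorem lemB (g : X0 →L[ℝ] ℝ) {ε : ℝ} (hε : 0 < ε) :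
    ∃ F : Finset ℕ, ∃ η > 0, ∀ f : X0 →L[ℝ] ℝ, (∀ j ∈ F, |f (e j)| ≤ η) →
      ‖g‖ + ‖f‖ - 5 * ε ≤ ‖g + f‖ := by
  obtain ⟨F, a, ha, hga⟩ := exists_near_fs g hε
  refine ⟨F, ε / (F.card + 1), by positivity, fun f hf => ?_⟩
  have hsm : ∀ b : ℕ → ℝ, (∀ n, |b n| ≤ 1) → |f (fs F b)| ≤ ε := by
    intro b hb
    rw [apply_fs]
    refine (Finset.abs_sum_le_sum_abs _ _).trans ?_
    have : ∑ j ∈ F, |b j * f (e j)| ≤ ∑ j ∈ F, ε / (F.card + 1) := by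
      refine Finset.sum_le_sum fun j hj => ?_
      rw [abs_mul]
      have := hf j hj
      have := hb j
      nlinarith [abs_nonneg (b j), abs_nonneg (f (e j))]
    refine this.trans ?_
    rw [Finset.sum_const, nsmul_eq_mul, mul_div_assoc', div_le_iff₀ (by positivity)]
    nlinarith
  obtain ⟨y, hy, hfy⟩ := exists_near f hε
  have hy1 : ∀ n, |y n| ≤ 1 := fun n => (abs_le_norm y n).trans hy
  have n1 : ‖fs F a + (y - fs F y)‖ ≤ 1 := by
    rw [norm_le_iff zero_le_one]
    intro n
    rw [addA, subA, fs_apply, fs_apply]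
    split_ifs with hn
    · simpa using ha n
    · simpa using hy1 n
  have n2 : ‖fs F a - (y - fs F y)‖ ≤ 1 := by
    rw [norm_le_iff zero_le_one]
    intro n
    rw [subA, subA, fs_apply, fs_apply]
    split_ifs with hn
    · simpa using ha n
    · simpa using hy1 n
  have h1 := apply_le g _ n2
  have h2 := apply_le (g + f) _ n1
  have h3 := abs_le.1 (hsm a ha)
  have h4 := abs_le.1 (hsm y hy1)
  simp only [map_sub, map_add, add_apply] at h1 h2
  linarith

section

variable {Y : Submodule ℝ X0}

theorem ev_small {z : ℕ → Y} (hz0 : ∀ j, Tendsto (fun k => (z k : X0) j) atTop (𝓝 0))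
    (F : Finset ℕ) {η : ℝ} (hη : 0 < η) : ∀ᶠ k in atTop, ∀ j ∈ F, |(z k : X0) j| ≤ η := by
  rw [Filter.eventually_all_finset]
  intro j _
  have := (Metric.tendsto_nhds.1 (hz0 j)) η hη
  filter_upwards [this] with k hk
  rw [dist_zero_right] at hk
  exact hk.le

theorem lemG {W : Type*} [NormedAddCommGroup W] [NormedSpace ℝ W] (S : Y →L[ℝ] W)
    {M : ℝ} (hM : 0 ≤ M) {z : ℕ → Y} (hz : ∀ k, ‖z k‖ ≤ M)
    (hz0 : ∀ j, Tendsto (fun k => (z k : X0) j) atTop (𝓝 0)) {δ : ℝ} (hδ : 0 < δ)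
    (h : ∀ u : Y, ∃ᶠ k in atTop, ‖S u‖ + δ ≤ ‖S (u + z k)‖ ∨ ‖S u‖ + δ ≤ ‖S (u - z k)‖) :
    False := by
  have key : ∀ N : ℕ, ∃ u : Y, ‖u‖ < M + 1 ∧ N * δ ≤ ‖S u‖ := by
    intro N
    induction N with
    | zero => exact ⟨0, by rw [norm_zero]; linarith, by simp⟩
    | succ N ih =>
      obtain ⟨u, hu, hSu⟩ := ih
      obtain ⟨F, η, hη, H⟩ := lemA hM (u : X0) hu
      obtain ⟨k, hk, hkF⟩ := ((h u).and_eventually (ev_small hz0 F hη)).exists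
      push_cast
      rcases hk with hk | hk
      · exact ⟨u + z k, H _ (hz k) hkF, by linarith⟩
      · refine ⟨u - z k, ?_, by linarith⟩
        have := H (-(z k : X0)) (by rw [norm_neg]; exact hz k) (fun j hj => by
          rw [negA, abs_neg]; exact hkF j hj)
        rw [← sub_eq_add_neg] at this
        exact this
  obtain ⟨N, hN⟩ := exists_nat_gt (‖S‖ * (M + 1) / δ)
  obtain ⟨u, hu, hSu⟩ := key N
  rw [div_lt_iff₀ hδ] at hN
  have := S.le_opNorm u
  nlinarith [norm_nonneg S]

theorem lemC (φ : Y →L[ℝ] ℝ)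
    {M : ℝ} (hM : 0 ≤ M) {z : ℕ → Y} (hz : ∀ k, ‖z k‖ ≤ M)
    (hz0 : ∀ j, Tendsto (fun k => (z k : X0) j) atTop (𝓝 0)) {δ : ℝ} (hδ : 0 < δ) :
    ∀ᶠ k in atTop, |φ (z k)| ≤ δ := by
  by_contra hc
  rw [Filter.not_eventually] at hc
  refine lemG φ hM hz hz0 hδ fun u => hc.mono fun k hk => ?_
  rw [not_le] at hk
  simp only [map_add, map_sub, Real.norm_eq_abs]
  rcases abs_cases (φ u) with ⟨h1, h1'⟩ | ⟨h1, h1'⟩ <;>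
  rcases abs_cases (φ (z k)) with ⟨h2, h2'⟩ | ⟨h2, h2'⟩ <;> rw [h1] <;> rw [h2] at hk
  · left; rw [le_abs]; left; linarith
  · right; rw [le_abs]; left; linarith
  · right; rw [le_abs]; right; linarith
  · left; rw [le_abs]; right; linarith

theorem lemD (T : Y →L[ℝ] (X0 →L[ℝ] ℝ))
    {M : ℝ} (hM : 0 ≤ M) {z : ℕ → Y} (hz : ∀ k, ‖z k‖ ≤ M)
    (hz0 : ∀ j, Tendsto (fun k => (z k : X0) j) atTop (𝓝 0)) {ε : ℝ} (hε : 0 < ε)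
    (h : ∀ k, ε ≤ ‖T (z k)‖) : False := by
  refine lemG T hM hz hz0 (half_pos hε) fun u => Filter.Eventually.frequently ?_
  obtain ⟨F, η, hη, H⟩ := lemB (T u) (ε := ε / 10) (by linarith)
  have : ∀ᶠ k in atTop, ∀ j ∈ F, |T (z k) (e j)| ≤ η := by
    rw [Filter.eventually_all_finset]
    intro j _
    exact lemC ((ContinuousLinearMap.apply ℝ ℝ (e j)).comp T) hM hz hz0 hη
  filter_upwards [this] with k hk
  left
  have h1 := H _ hk
  have h2 := h k
  rw [map_add]
  linarith

theorem compactOp (T : Y →L[ℝ] (X0 →L[ℝ] ℝ)) : IsCompactOp T := by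
  unfold IsCompactOp
  refine TotallyBounded.isCompact_of_isClosed (TotallyBounded.closure ?_) isClosed_closure
  by_contra hc
  rw [Metric.totallyBounded_iff] at hc
  push Not at hc
  obtain ⟨ε, hε, hc⟩ := hc
  obtain ⟨y, hy, hsep⟩ := exists_seq_of_forall_finset_exists (fun y : Y => ‖y‖ ≤ 1)
    (fun a b => ε ≤ ‖T b - T a‖) (by
      intro s hs
      have := hc (T '' (s : Set Y)) (s.finite_toSet.image _)
      rw [Set.not_subset] at this
      obtain ⟨_, ⟨b, hb, rfl⟩, hb2⟩ := this
      refine ⟨b, by simpa using hb, fun a ha => ?_⟩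
      by_contra hlt
      rw [not_le, ← dist_eq_norm] at hlt
      apply hb2
      simp only [Set.mem_iUnion]
      exact ⟨T a, ⟨a, ha, rfl⟩, hlt⟩)
  have hK : IsCompact (Set.pi Set.univ fun _ : ℕ => Set.Icc (-1 : ℝ) 1) :=
    isCompact_univ_pi fun _ => isCompact_Icc
  obtain ⟨l, -, φ, hφ, hl⟩ := hK.tendsto_subseq (x := fun k n => (y k : X0) n) (by
    intro k n _
    exact abs_le.1 ((abs_le_norm _ n).trans (hy k)))
  rw [tendsto_pi_nhds] at hl
  refine lemD T (M := 2) (by norm_num) (z := fun k => y (φ (k + 1)) - y (φ k)) ?_ ?_ hε ?_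
  · intro k
    refine (norm_sub_le _ _).trans ?_
    linarith [hy (φ (k + 1)), hy (φ k)]
  · intro j
    have h1 := ((hl j).comp (tendsto_add_atTop_nat 1)).sub (hl j)
    rw [sub_self] at h1
    exact h1
  · intro k
    rw [map_sub]
    exact hsep _ _ (hφ (Nat.lt_succ_self k))

end

theorem sum_le (f : X0 →L[ℝ] ℝ) (F : Finset ℕ) : ∑ j ∈ F, |f (e j)| ≤ ‖f‖ := by
  have h := apply_le f (fs F fun j => SignType.sign (f (e j))) (by
    rw [norm_le_iff zero_le_one]
    intro n
    rw [fs_apply]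
    split_ifs
    · rcases lt_trichotomy (f (e n)) 0 with h | h | h <;> simp [h]
    · simp)
  rw [apply_fs] at h
  simpa [sign_mul_self] using h

theorem not_reflexive : ¬ IsReflexiveSpace X0 := by
  intro h
  have hs : ∀ f : X0 →L[ℝ] ℝ, Summable fun j => f (e j) := fun f =>
    (summable_of_sum_le (fun _ => abs_nonneg _) (sum_le f)).of_abs
  let L : (X0 →L[ℝ] ℝ) →L[ℝ] ℝ := LinearMap.mkContinuous
    { toFun := fun f => ∑' j, f (e j)
      map_add' := fun f g => (hs f).tsum_add (hs g)
      map_smul' := fun c f => by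
        simp [tsum_mul_left] } 1 (fun f => by
          rw [one_mul]
          have hsa : Summable fun j => ‖f (e j)‖ :=
            summable_of_sum_le (fun _ => norm_nonneg _) (sum_le f)
          exact (norm_tsum_le_tsum_norm hsa).trans (hsa.tsum_le_of_sum_le (sum_le f)))
  obtain ⟨x, hx⟩ := h L
  have hx1 : ∀ n, x n = 1 := by
    intro n
    have h1 : x n = L (ev n) := by
      rw [← hx]; rfl
    rw [h1]
    change ∑' j, e j n = 1
    simp [e_apply]
  obtain ⟨F, hF⟩ := exists_small x (δ := 1) one_pos
  obtain ⟨n, hn⟩ := Infinite.exists_notMem_finset F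
  have := hF n hn
  rw [hx1] at this
  simp at this

end CZ

/-- a non-reflexive Banach space such that every operator from any closed
subspace into the dual is compact. -/
theorem statement5 : ∃ (X : Type) (_ : NormedAddCommGroup X) (_ : NormedSpace ℝ X)
    (_ : CompleteSpace X),
    ¬ IsReflexiveSpace X ∧
    ∀ Y : Submodule ℝ X, IsClosed (Y : Set X) →
      ∀ T : Y →L[ℝ] (X →L[ℝ] ℝ), IsCompactOp T := by
  exact ⟨CZ.X0, inferInstance, inferInstance, inferInstance, CZ.not_reflexive, fun Y _ T => CZ.compactOp T⟩
end
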